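/- arXiv:2104.07443 — 3 statements merged into one kernel-verified Lean document; each statement's English description precedes it below -/
import Mathlib

section
/- Let B(n) = A(n) − A*(n), where A(n) = Σ_{p^ν || n} ν·p and A*(n) = Σ_{p | n} p are the Alladi–Erdős functions. Then Σ_{n ≤ x} B(n) = x·log log √x + F·x + O( x / log x ) as x → ∞, where F = γ + Σ_p ( log(1 − 1/p) + 1/(p−1) ) (the sum over all primes, absolutely convergent) and log log √x = log( (log x)/2 ). -/
namespace Stmt17
open Finset Filter Topology Nat.Prime
open scoped Nat.Prime

/-- `S N = ∑_{p ≤ N} 1/(p-1)`. -/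
noncomputable def S (N : ℕ) : ℝ := ∑ p ∈ Nat.primesLE N, 1 / ((p : ℝ) - 1)

/-- `T N = ∑_{p ≤ N} log p/(p-1)`. -/
noncomputable def T (N : ℕ) : ℝ := ∑ p ∈ Nat.primesLE N, Real.log p / ((p : ℝ) - 1)

lemma vp_bounds {p : ℕ} (hp : p.Prime) (N : ℕ) :
    (N : ℝ) / ((p : ℝ) - 1) - (Nat.log p N + 1) ≤ (N.factorial.factorization p : ℝ) ∧
    (N.factorial.factorization p : ℝ) ≤ (N : ℝ) / ((p : ℝ) - 1) := by
  have : Fact p.Prime := ⟨hp⟩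
  have h := sub_one_mul_padicValNat_factorial (p := p) N
  rw [← Nat.factorization_def _ hp] at h
  have hs : (p.digits N).sum ≤ (p.digits N).length * (p - 1) := by
    have := List.sum_le_card_nsmul (p.digits N) (p - 1)
      (fun d hd => Nat.le_sub_one_of_lt (Nat.digits_lt_base hp.one_lt hd))
    simpa using this
  have hl : (p.digits N).length ≤ Nat.log p N + 1 := by
    rcases eq_or_ne N 0 with rfl | hN
    · simp
    · rw [Nat.length_digits p N hp.one_lt hN]
  have hsN : (p.digits N).sum ≤ N := Nat.digit_sum_le p N
  generalize (p.digits N).sum = D at *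
  have h2 := hp.two_le
  have hp1 : (0 : ℝ) < (p : ℝ) - 1 := by
    have : (2 : ℝ) ≤ p := by exact_mod_cast h2
    linarith
  have hR : ((p : ℝ) - 1) * (N.factorial.factorization p : ℝ) + (D : ℝ) = N := by
    have h' : (p - 1) * N.factorial.factorization p + D = N := by omega
    have := congrArg (Nat.cast : ℕ → ℝ) h'
    push_cast [Nat.cast_sub hp.one_le] at this
    exact this
  have hsR : (D : ℝ) ≤ (Nat.log p N + 1) * ((p : ℝ) - 1) := by
    have : D ≤ (Nat.log p N + 1) * (p - 1) :=
      hs.trans (Nat.mul_le_mul_right _ hl)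
    have := (Nat.cast_le (α := ℝ)).2 this
    push_cast [Nat.cast_sub hp.one_le] at this
    exact this
  constructor
  · rw [sub_le_iff_le_add, div_le_iff₀ hp1]
    nlinarith
  · rw [le_div_iff₀ hp1]
    have : (0 : ℝ) ≤ (D : ℝ) := by positivity
    linarith

lemma log_factorial_eq (N : ℕ) :
    Real.log (N.factorial : ℝ) = ∑ p ∈ Nat.primesLE N, (N.factorial.factorization p : ℝ) * Real.log p := by
  have h := Nat.prod_primeFactors_pow_factorization N.factorial_ne_zero
  have hsub : N.factorial.primeFactors ⊆ Nat.primesLE N := by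
    intro p hp
    have hpp := Nat.prime_of_mem_primeFactors hp
    exact Nat.mem_primesLE.2 ⟨(hpp.dvd_factorial).1 (Nat.dvd_of_mem_primeFactors hp), hpp⟩
  have h2 : ((N.factorial : ℕ) : ℝ) = ∏ p ∈ Nat.primesLE N, (p : ℝ) ^ N.factorial.factorization p := by
    have : N.factorial = ∏ p ∈ Nat.primesLE N, p ^ N.factorial.factorization p := by
      conv_lhs => rw [h]
      apply Finset.prod_subset hsub
      intro p _ hp
      rw [← Nat.support_factorization, Finsupp.notMem_support_iff] at hp
      simp [hp]
    exact_mod_cast congrArg (Nat.cast : ℕ → ℝ) this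
  rw [h2, Real.log_prod]
  · simp [Real.log_pow]
  · intro p hp
    have := (Nat.prime_of_mem_primesLE hp).pos
    positivity

lemma log_factorial_bounds (N : ℕ) :
    (N : ℝ) * Real.log N - N ≤ Real.log (N.factorial : ℝ) ∧ Real.log (N.factorial : ℝ) ≤ N * Real.log N := by
  rcases Nat.eq_zero_or_pos N with rfl | hN
  · simp
  have hN' : (0 : ℝ) < N := by exact_mod_cast hN
  constructor
  · have h := Real.pow_div_factorial_le_exp (x := (N : ℝ)) hN'.le N
    have h1 : (N : ℝ) ^ N / N.factorial ≤ Real.exp N := h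
    have h2 := Real.log_le_log (by positivity) h1
    rw [Real.log_div (by positivity) (by positivity), Real.log_pow, Real.log_exp] at h2
    linarith
  · have : (N.factorial : ℝ) ≤ (N : ℝ) ^ N := by exact_mod_cast Nat.factorial_le_pow N
    have h2 := Real.log_le_log (by positivity) this
    rwa [Real.log_pow] at h2

lemma mertens1 : ∃ C : ℝ, 0 < C ∧ ∀ N : ℕ, 1 ≤ N → |T N - Real.log N| ≤ C := by
  have h4 : 0 < Real.log 4 := Real.log_pos (by norm_num)
  refine ⟨(Real.log 4 + 4) + Real.log 4 + 1, by positivity, fun N hN => ?_⟩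
  have hN' : (0 : ℝ) < N := by exact_mod_cast hN
  have hψ := Chebyshev.psi_le_const_mul_self hN'.le
  have hθ := Chebyshev.theta_le_log4_mul_x hN'.le
  rw [Chebyshev.psi_eq_sum_mul_log_prime] at hψ
  rw [Chebyshev.theta_eq_sum_primesLE_log] at hθ
  have hlf := log_factorial_eq N
  obtain ⟨hb1, hb2⟩ := log_factorial_bounds N
  have hT : N * T N = ∑ p ∈ Nat.primesLE N, (N : ℝ) / ((p : ℝ) - 1) * Real.log p := by
    rw [T, Finset.mul_sum]
    exact Finset.sum_congr rfl fun p _ => by ring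
  have hup : Real.log (N.factorial : ℝ) ≤ N * T N := by
    rw [hlf, hT]
    refine Finset.sum_le_sum fun p hp => ?_
    exact mul_le_mul_of_nonneg_right (vp_bounds (Nat.prime_of_mem_primesLE hp) N).2 (Real.log_natCast_nonneg p)
  have hlo : N * T N - (∑ p ∈ Nat.primesLE N, Nat.log p N * Real.log p + ∑ p ∈ Nat.primesLE N, Real.log p)
      ≤ Real.log (N.factorial : ℝ) := by
    rw [hlf, hT, ← Finset.sum_add_distrib, ← Finset.sum_sub_distrib]
    refine Finset.sum_le_sum fun p hp => ?_
    have := mul_le_mul_of_nonneg_right (vp_bounds (Nat.prime_of_mem_primesLE hp) N).1 (Real.log_natCast_nonneg p)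
    linarith
  rw [abs_le]
  constructor
  · by_contra hc
    push Not at hc
    have := mul_lt_mul_of_pos_left hc hN'
    nlinarith
  · by_contra hc
    push Not at hc
    have := mul_lt_mul_of_pos_left hc hN'
    nlinarith

lemma S_succ (n : ℕ) : S (n + 1) = S n + if (n+1).Prime then 1 / (((n + 1 : ℕ) : ℝ) - 1) else 0 := by
  unfold S
  rw [Nat.primesLE_eq_filter_range, Nat.primesLE_eq_filter_range, Finset.sum_filter, Finset.sum_filter,
    Finset.sum_range_succ _ (n+1)]

lemma T_succ (n : ℕ) : T (n + 1) = T n + if (n+1).Prime then Real.log (n + 1 : ℕ) / (((n + 1 : ℕ) : ℝ) - 1) else 0 := by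
  unfold T
  rw [Nat.primesLE_eq_filter_range, Nat.primesLE_eq_filter_range, Finset.sum_filter, Finset.sum_filter,
    Finset.sum_range_succ _ (n+1)]

lemma mertens2 : ∃ M K : ℝ, 0 < K ∧ ∀ n : ℕ, 2 ≤ n →
    |S n - Real.log (Real.log n) - M| ≤ K / Real.log n := by
  obtain ⟨C, hC, hT⟩ := mertens1
  set w : ℕ → ℝ := fun n => 1 / Real.log n with hw
  set Q : ℕ → ℝ := fun n => S n - Real.log (Real.log n) - (T n - Real.log n) * w n with hQ
  have hstep : ∀ n : ℕ, 2 ≤ n → |Q (n+1) - Q n| ≤ (1 + C) * (w n - w (n+1)) := by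
    intro n hn
    have hn' : (2 : ℝ) ≤ n := by exact_mod_cast hn
    set a := Real.log n with ha
    set b := Real.log (n+1 : ℕ) with hb
    have ha0 : 0 < a := Real.log_pos (by linarith)
    have hab : a ≤ b := Real.log_le_log (by linarith) (by push_cast; linarith)
    have hb0 : 0 < b := by linarith
    have hba : b - a ≤ 1 := by
      rw [ha, hb, ← Real.log_div (by positivity) (by positivity)]
      refine (Real.log_le_sub_one_of_pos (by positivity)).trans ?_
      push_cast
      rw [sub_le_iff_le_add, div_le_iff₀ (by linarith)]
      linarith
    have hSr : S (n+1) - S n = (T (n+1) - T n) * (1 / b) := by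
      rw [S_succ, T_succ]
      split_ifs
      · rw [← hb]; field_simp; ring
      · simp
    have hR := hT n (by omega)
    rw [← ha] at hR
    have key : Q (n+1) - Q n = ((b - a) * (1 / b) - (Real.log b - Real.log a))
        + (T n - a) * (1 / a - 1 / b) := by
      simp only [hQ, hw, ← ha, ← hb]
      have hb1 : b * (1 / b) = 1 := by field_simp
      linear_combination hSr
    have hl1 : Real.log b - Real.log a ≤ (b - a) * (1 / a) := by
      rw [← Real.log_div hb0.ne' ha0.ne']
      refine (Real.log_le_sub_one_of_pos (by positivity)).trans (le_of_eq ?_)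
      field_simp
    have hl2 : (b - a) * (1 / b) ≤ Real.log b - Real.log a := by
      have := Real.log_le_sub_one_of_pos (x := a / b) (by positivity)
      rw [Real.log_div ha0.ne' hb0.ne'] at this
      have h3 : (b - a) * (1 / b) = 1 - a / b := by field_simp
      linarith
    have hw0 : 0 ≤ 1 / a - 1 / b := sub_nonneg.2 (one_div_le_one_div_of_le ha0 hab)
    have hww : w n - w (n+1) = 1 / a - 1 / b := by simp only [hw, ← ha, ← hb]
    rw [key, hww]
    have h1 : |(b - a) * (1 / b) - (Real.log b - Real.log a)| ≤ 1 * (1 / a - 1 / b) := by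
      rw [abs_le]
      constructor
      · have := mul_le_mul_of_nonneg_right hba hw0
        nlinarith
      · linarith
    have h2 : |(T n - a) * (1 / a - 1 / b)| ≤ C * (1 / a - 1 / b) := by
      rw [abs_mul, abs_of_nonneg hw0]
      exact mul_le_mul_of_nonneg_right hR hw0
    calc _ ≤ _ := abs_add_le _ _
      _ ≤ 1 * (1 / a - 1 / b) + C * (1 / a - 1 / b) := add_le_add h1 h2
      _ = _ := by ring
  have hdist : ∀ n : ℕ, 2 ≤ n → ∀ m, n ≤ m → |Q m - Q n| ≤ (1 + C) * (w n - w m) := by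
    intro n hn m hm
    induction m, hm using Nat.le_induction with
    | base => simp
    | succ m hm ih =>
      have := hstep m (by omega)
      have e : Q (m+1) - Q n = (Q (m+1) - Q m) + (Q m - Q n) := by ring
      rw [e]
      refine (abs_add_le _ _).trans ?_
      linarith
  have hwnn : ∀ n : ℕ, 0 ≤ w n := fun n => by
    simp only [hw]; exact div_nonneg zero_le_one (Real.log_natCast_nonneg n)
  have hdist' : ∀ n : ℕ, 2 ≤ n → ∀ m, n ≤ m → |Q m - Q n| ≤ (1 + C) * w n := by
    intro n hn m hm
    refine (hdist n hn m hm).trans ?_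
    have := hwnn m
    nlinarith
  have hwt : Tendsto (fun n => (1 + C) * w (n+2)) atTop (𝓝 0) := by
    have h0 : Tendsto (fun n : ℕ => Real.log ((n : ℕ) : ℝ)) atTop atTop :=
      Real.tendsto_log_atTop.comp tendsto_natCast_atTop_atTop
    have h1 : Tendsto w atTop (𝓝 0) := by
      have h2 : w = (fun n : ℕ => Real.log ((n : ℕ) : ℝ))⁻¹ := by
        funext n; simp [hw]
      rw [h2]
      exact h0.inv_tendsto_atTop
    have := ((tendsto_add_atTop_iff_nat 2).2 h1).const_mul (1 + C)
    simpa using this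
  have hcs : CauchySeq (fun n => Q (n+2)) := by
    refine cauchySeq_of_le_tendsto_0' (fun n => (1 + C) * w (n+2)) (fun n m hnm => ?_) hwt
    rw [dist_comm, Real.dist_eq]
    exact hdist' (n+2) (by omega) (m+2) (by omega)
  obtain ⟨M, hM⟩ := cauchySeq_tendsto_of_complete hcs
  refine ⟨M, 1 + 2 * C, by positivity, fun n hn => ?_⟩
  have hM' : Tendsto Q atTop (𝓝 M) := (tendsto_add_atTop_iff_nat 2).1 hM
  have hQM : |M - Q n| ≤ (1 + C) * w n :=
    le_of_tendsto ((hM'.sub_const (Q n)).abs) (eventually_atTop.2 ⟨n, fun m hm => hdist' n hn m hm⟩)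
  have hR : |(T n - Real.log n) * w n| ≤ C * w n := by
    rw [abs_mul, abs_of_nonneg (hwnn n)]
    exact mul_le_mul_of_nonneg_right (hT n (by omega)) (hwnn n)
  have e : S n - Real.log (Real.log n) - M = -(M - Q n) + (T n - Real.log n) * w n := by
    simp only [hQ]; ring
  rw [e]
  refine (abs_add_le _ _).trans ?_
  rw [abs_neg]
  have : (1 + 2 * C) / Real.log n = (1 + C) * w n + C * w n := by simp only [hw]; ring
  rw [this]
  exact add_le_add hQM hR


lemma sumB_eq (N : ℕ) :
    (∑ n ∈ Finset.Icc 1 N,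
          ((∑ p ∈ n.primeFactors, (n.factorization p : ℝ) * (p : ℝ)) -
            ∑ p ∈ n.primeFactors, (p : ℝ))) =
    ∑ p ∈ Nat.primesLE N, (p : ℝ) * ((N.factorial.factorization p : ℝ) - ((N / p : ℕ) : ℝ)) := by
  have h1 : ∀ n ∈ Finset.Icc 1 N, ((∑ p ∈ n.primeFactors, (n.factorization p : ℝ) * (p : ℝ)) -
            ∑ p ∈ n.primeFactors, (p : ℝ)) =
      ∑ p ∈ Nat.primesLE N, (p : ℝ) * ((n.factorization p : ℝ) - if p ∣ n then 1 else 0) := by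
    intro n hn
    rw [Finset.mem_Icc] at hn
    rw [← Finset.sum_sub_distrib]
    have hsub : n.primeFactors ⊆ Nat.primesLE N := by
      intro p hp
      have hpp := Nat.prime_of_mem_primeFactors hp
      exact Nat.mem_primesLE.2 ⟨(Nat.le_of_mem_primeFactors hp).trans hn.2, hpp⟩
    rw [← Finset.sum_subset hsub]
    · refine Finset.sum_congr rfl fun p hp => ?_
      rw [if_pos (Nat.dvd_of_mem_primeFactors hp)]
      ring
    · intro p hp hpn
      have hnd : ¬ p ∣ n := fun hd => hpn (Nat.mem_primeFactors.2
        ⟨Nat.prime_of_mem_primesLE hp, hd, by omega⟩)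
      simp [hnd, Nat.factorization_eq_zero_of_not_dvd hnd]
  rw [Finset.sum_congr rfl h1, Finset.sum_comm]
  refine Finset.sum_congr rfl fun p hp => ?_
  have hpp := Nat.prime_of_mem_primesLE hp
  rw [← Finset.mul_sum, Finset.sum_sub_distrib]
  congr 2
  · clear h1 hp
    induction N with
    | zero => simp
    | succ n ih =>
      rw [Finset.sum_Icc_succ_top (by omega), ih, Nat.factorial_succ,
        Nat.factorization_mul (by omega) n.factorial_ne_zero]
      simp [add_comm]
  · rw [← Finset.sum_filter, Finset.sum_const, nsmul_eq_mul, mul_one]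
    congr 1
    rw [← Nat.Ioc_filter_dvd_card_eq_div]
    rfl

lemma sumB_approx : ∃ C : ℝ, 0 < C ∧ ∃ N₀ : ℕ, ∀ N : ℕ, N₀ ≤ N →
    |(∑ n ∈ Finset.Icc 1 N,
          ((∑ p ∈ n.primeFactors, (n.factorization p : ℝ) * (p : ℝ)) -
            ∑ p ∈ n.primeFactors, (p : ℝ))) - N * S (Nat.sqrt N)| ≤ C * N / Real.log N := by
  have hev := Chebyshev.eventually_primeCounting_le (ε := 1) one_pos
  obtain ⟨y₀, hy₀⟩ := eventually_atTop.1 hev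
  have h4 : 0 < Real.log 4 := Real.log_pos (by norm_num)
  refine ⟨24 * (Real.log 4 + 1), by positivity, max 4 (⌈y₀ ^ 2⌉₊), fun N hN => ?_⟩
  have hN4 : 4 ≤ N := (le_max_left _ _).trans hN
  have hNR : (4 : ℝ) ≤ N := by exact_mod_cast hN4
  have hN0 : (0 : ℝ) < N := by linarith
  set y := Real.sqrt N with hy
  have hy2 : y * y = N := Real.mul_self_sqrt hN0.le
  have hyy0 : y₀ ≤ y := by
    have : y₀ ^ 2 ≤ N := (Nat.le_ceil _).trans (by exact_mod_cast (le_max_right _ _).trans hN)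
    exact (le_abs_self _).trans ((Real.abs_le_sqrt this))
  have hy1 : 2 ≤ y := by
    rw [hy]; apply Real.le_sqrt_of_sq_le; linarith
  have hlogy : Real.log N = 2 * Real.log y := by
    rw [← hy2, Real.log_mul (by positivity) (by positivity)]; ring
  have hly : 0 < Real.log y := Real.log_pos (by linarith)
  have hfl : ⌊y⌋₊ = Nat.sqrt N := by rw [hy, Real.nat_floor_real_sqrt_eq_nat_sqrt]
  have hpi := hy₀ y hyy0
  rw [hfl] at hpi
  have hlog2 : 0.6 < Real.log 2 := by have := Real.log_two_gt_d9; linarith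
  -- restrict
  have hres : ∑ p ∈ Nat.primesLE N, (p : ℝ) * ((N.factorial.factorization p : ℝ) - ((N / p : ℕ) : ℝ))
      = ∑ p ∈ Nat.primesLE (Nat.sqrt N), (p : ℝ) * ((N.factorial.factorization p : ℝ) - ((N / p : ℕ) : ℝ)) := by
    symm
    apply Finset.sum_subset (Nat.primesLE_mono (Nat.sqrt_le_self N))
    intro p hp hp2
    have hpp := Nat.prime_of_mem_primesLE hp
    have hlt : Nat.sqrt N < p := by
      by_contra hc
      exact hp2 (Nat.mem_primesLE.2 ⟨not_lt.1 hc, hpp⟩)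
    have hlog : Nat.log p N < 2 := by
      apply Nat.log_lt_of_lt_pow (by omega)
      rw [pow_two]; exact Nat.sqrt_lt.1 hlt
    rw [Nat.factorization_factorial hpp hlog]
    simp
  rw [sumB_eq, hres, S, Finset.mul_sum, ← Finset.sum_sub_distrib]
  refine (Finset.abs_sum_le_sum_abs _ _).trans ?_
  have hterm : ∀ p ∈ Nat.primesLE (Nat.sqrt N),
      |(p : ℝ) * ((N.factorial.factorization p : ℝ) - ((N / p : ℕ) : ℝ)) - N * (1 / ((p : ℝ) - 1))| ≤ 12 * y := by
    intro p hp
    have hpp := Nat.prime_of_mem_primesLE hp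
    have hp2 : (2 : ℝ) ≤ p := by exact_mod_cast hpp.two_le
    have hpy : (p : ℝ) ≤ y := by
      have := Nat.le_of_mem_primesLE hp
      rw [← hfl] at this
      exact (Nat.le_floor_iff (by linarith)).1 this
    have hlp : 0.6 < Real.log p := hlog2.trans_le (Real.log_le_log (by norm_num) hp2)
    obtain ⟨hv1, hv2⟩ := vp_bounds hpp N
    have hd1 : ((N / p : ℕ) : ℝ) ≤ N / p := Nat.cast_div_le
    have hd2 : (N : ℝ) / p - 1 ≤ ((N / p : ℕ) : ℝ) := by
      have := Nat.lt_div_mul_add (a := N) (b := p) hpp.pos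
      have h' : (N : ℝ) < ((N / p : ℕ) : ℝ) * p + p := by exact_mod_cast this
      rw [sub_le_iff_le_add, div_le_iff₀ (by linarith)]
      linarith
    have hlogb : (Nat.log p N : ℝ) ≤ Real.log N / Real.log p := by
      rw [le_div_iff₀ (by linarith), ← Real.log_pow]
      apply Real.log_le_log (by positivity)
      exact_mod_cast Nat.pow_log_le_self p (by omega)
    have e : (p : ℝ) * ((N.factorial.factorization p : ℝ) - ((N / p : ℕ) : ℝ)) - N * (1 / ((p : ℝ) - 1))
        = p * ((N.factorial.factorization p : ℝ) - N / ((p : ℝ) - 1)) + p * (N / p - ((N / p : ℕ) : ℝ)) := by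
      have : (p : ℝ) - 1 ≠ 0 := by linarith
      field_simp
      ring
    -- p * log y / log p ≤ 3 y
    have hkey : (p : ℝ) * (Real.log y / Real.log p) ≤ 3 * y := by
      have h1 : Real.log (y / p) ≤ y / p - 1 := Real.log_le_sub_one_of_pos (by positivity)
      rw [Real.log_div (by positivity) (by positivity)] at h1
      have h2 : Real.log y / Real.log p ≤ 3 * (y / p) := by
        rw [div_le_iff₀ (by linarith)]
        have h3 : 1 ≤ y / p := by rw [le_div_iff₀ (by linarith)]; linarith
        nlinarith
      calc (p : ℝ) * (Real.log y / Real.log p) ≤ p * (3 * (y / p)) := by gcongr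
        _ = 3 * y := by field_simp
    have hkey2 : (p : ℝ) * Nat.log p N ≤ 6 * y := by
      calc (p : ℝ) * Nat.log p N ≤ p * (Real.log N / Real.log p) := by gcongr
        _ = 2 * (p * (Real.log y / Real.log p)) := by rw [hlogy]; ring
        _ ≤ _ := by linarith
    rw [e, abs_le]
    constructor
    · have h1 := mul_le_mul_of_nonneg_left hv1 (by linarith : (0:ℝ) ≤ p)
      have h2 := mul_le_mul_of_nonneg_left hd1 (by linarith : (0:ℝ) ≤ p)
      nlinarith
    · have h1 := mul_le_mul_of_nonneg_left hv2 (by linarith : (0:ℝ) ≤ p)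
      have h2 := mul_le_mul_of_nonneg_left hd2 (by linarith : (0:ℝ) ≤ p)
      nlinarith
  refine (Finset.sum_le_card_nsmul _ _ _ hterm).trans ?_
  rw [nsmul_eq_mul, Nat.primesLE_card_eq_primeCounting]
  calc ((Nat.primeCounting (Nat.sqrt N) : ℕ) : ℝ) * (12 * y)
      ≤ ((Real.log 4 + 1) * y / Real.log y) * (12 * y) := by gcongr
    _ = 24 * (Real.log 4 + 1) * N / Real.log N := by
      rw [hlogy, ← hy2]; field_simp; ring


lemma hs_congr {f g : ℕ → ℝ} {a : ℝ} (h : HasSum g a) (hf : ∀ n, f n = g n) : HasSum f a := by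
  rw [funext hf]; exact h

/-- the local term -/
noncomputable def e (s : ℝ) (p : Nat.Primes) : ℝ :=
  Real.log (1 - ((p : ℕ) : ℝ) ^ (-(1 + s))) + ((p : ℕ) : ℝ) ^ (-s) / (((p : ℕ) : ℝ) - 1)

lemma two_le_p (p : Nat.Primes) : (2 : ℝ) ≤ ((p : ℕ) : ℝ) := by exact_mod_cast p.2.two_le

lemma e_zero (p : Nat.Primes) :
    e 0 p = Real.log (1 - 1 / ((p : ℕ) : ℝ)) + 1 / (((p : ℕ) : ℝ) - 1) := by
  have := two_le_p p
  simp [e, Real.rpow_neg_one]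

lemma summable_sq : Summable (fun p : Nat.Primes => 4 * ((p : ℕ) : ℝ) ^ (-2 : ℝ)) :=
  (Nat.Primes.summable_rpow.2 (by norm_num)).mul_left 4

lemma e_bound {s : ℝ} (hs : 0 ≤ s) (p : Nat.Primes) : ‖e s p‖ ≤ 4 * ((p : ℕ) : ℝ) ^ (-2 : ℝ) := by
  have hp := two_le_p p
  set q : ℝ := ((p : ℕ) : ℝ) with hq
  have hq0 : 0 < q := by linarith
  set t := q ^ (-s) with ht
  have ht0 : 0 < t := Real.rpow_pos_of_pos hq0 _
  have ht1 : t ≤ 1 := Real.rpow_le_one_of_one_le_of_nonpos (by linarith) (by linarith)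
  have hu : q ^ (-(1 + s)) = t / q := by
    rw [show -(1 + s) = -s - 1 by ring, Real.rpow_sub_one hq0.ne']
  have h2 : q ^ (-2 : ℝ) = 1 / q ^ 2 := by
    rw [Real.rpow_neg hq0.le]; norm_num
  rw [Real.norm_eq_abs, e, ← hq, hu, h2, ← ht]
  set u := t / q with huu
  have hu0 : 0 < u := by positivity
  have huq : u ≤ 1 / q := by rw [huu]; gcongr
  have hq2 : 1 / q ≤ 1 / 2 := one_div_le_one_div_of_le (by norm_num) hp
  have h3 := Real.abs_log_sub_add_sum_range_le (x := u) (by rw [abs_of_pos hu0]; linarith) 1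
  simp only [Finset.sum_range_one, zero_add, pow_one, Nat.cast_zero, div_one] at h3
  rw [abs_of_pos hu0] at h3
  have h4 : u ^ (1 + 1) / (1 - u) ≤ 2 * (1 / q ^ 2) := by
    rw [div_le_iff₀ (by linarith)]
    have : u ^ 2 ≤ (1 / q) ^ 2 := by gcongr
    have e1 : (1 / q) ^ 2 = 1 / q ^ 2 := by ring
    rw [e1] at this
    have h5 : 0 < 1 / q ^ 2 := by positivity
    nlinarith
  have h6 : t / (q - 1) - u = t * (1 / (q * (q - 1))) := by
    have : q - 1 ≠ 0 := by linarith
    rw [huu]; field_simp; ring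
  have h7 : 1 / (q * (q - 1)) ≤ 2 * (1 / q ^ 2) := by
    rw [div_le_iff₀ (by nlinarith)]
    field_simp
    nlinarith
  have h8 : 0 < 1 / (q * (q - 1)) := by
    apply div_pos one_pos; nlinarith
  have h9 : |t / (q - 1) - u| ≤ 2 * (1 / q ^ 2) := by
    rw [h6, abs_of_pos (by positivity)]
    nlinarith
  have e2 : Real.log (1 - u) + t / (q - 1) = (u + Real.log (1 - u)) + (t / (q - 1) - u) := by ring
  rw [e2]
  refine (abs_add_le _ _).trans ?_
  linarith

lemma summable_e {s : ℝ} (hs : 0 ≤ s) : Summable (e s) :=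
  Summable.of_norm_bounded summable_sq (e_bound hs)

lemma tendsto_E : Tendsto (fun s => ∑' p, e s p) (𝓝[>] 0) (𝓝 (∑' p, e 0 p)) := by
  refine tendsto_tsum_of_dominated_convergence summable_sq (fun p => ?_) ?_
  · have hp := two_le_p p
    have hc : ContinuousAt (fun s => e s p) 0 := by
      unfold e
      have h1 : ContinuousAt (fun s : ℝ => ((p : ℕ) : ℝ) ^ (-(1 + s))) 0 := by
        refine ContinuousAt.rpow continuousAt_const (by fun_prop) (Or.inl (by linarith))
      have h2 : ContinuousAt (fun s : ℝ => ((p : ℕ) : ℝ) ^ (-s)) 0 := by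
        refine ContinuousAt.rpow continuousAt_const (by fun_prop) (Or.inl (by linarith))
      refine ContinuousAt.add (ContinuousAt.log (continuousAt_const.sub h1) ?_) (h2.div_const _)
      have : ((p : ℕ) : ℝ) ^ (-(1 + (0:ℝ))) ≤ 1 / 2 := by
        rw [add_zero, Real.rpow_neg_one, ← one_div]
        exact one_div_le_one_div_of_le (by norm_num) hp
      intro h0
      norm_num at h0 this
      linarith
    exact hc.tendsto.mono_left nhdsWithin_le_nhds
  · filter_upwards [self_mem_nhdsWithin] with s hs p
    exact e_bound (le_of_lt hs) p

/-- `P s = ∑ p^{-s}/(p-1)` -/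
lemma summable_P {s : ℝ} (hs : 0 < s) :
    Summable (fun p : Nat.Primes => ((p : ℕ) : ℝ) ^ (-s) / (((p : ℕ) : ℝ) - 1)) := by
  refine Summable.of_nonneg_of_le (fun p => ?_) (fun p => ?_)
    ((Nat.Primes.summable_rpow.2 (by linarith : -(1+s) < -1)).mul_left 2)
  · have := two_le_p p
    exact div_nonneg (by positivity) (by linarith)
  · have := two_le_p p
    have h0 : (0:ℝ) < ((p : ℕ) : ℝ) := by linarith
    have h1 : (0:ℝ) < ((p : ℕ) : ℝ) ^ (-s) := by positivity
    rw [show -(1 + s) = -s - 1 by ring, Real.rpow_sub_one h0.ne', div_le_iff₀ (by linarith)]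
    rw [show 2 * (((p : ℕ) : ℝ) ^ (-s) / ((p : ℕ) : ℝ)) * (((p : ℕ) : ℝ) - 1) =
      ((p : ℕ) : ℝ) ^ (-s) * (2 * (((p : ℕ) : ℝ) - 1) / ((p : ℕ) : ℝ)) by ring]
    apply le_mul_of_one_le_right h1.le
    rw [le_div_iff₀ h0]
    linarith

lemma summable_L {s : ℝ} (hs : 0 < s) :
    Summable (fun p : Nat.Primes => -Real.log (1 - ((p : ℕ) : ℝ) ^ (-(1 + s)))) := by
  refine ((summable_P hs).sub (summable_e hs.le)).congr fun p => ?_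
  simp only [e]; ring

lemma P_eq {s : ℝ} (hs : 0 < s) :
    ∑' p : Nat.Primes, ((p : ℕ) : ℝ) ^ (-s) / (((p : ℕ) : ℝ) - 1) =
      (∑' p : Nat.Primes, -Real.log (1 - ((p : ℕ) : ℝ) ^ (-(1 + s)))) + ∑' p, e s p := by
  rw [← (summable_L hs).tsum_add (summable_e hs.le)]
  refine tsum_congr fun p => ?_
  simp only [e]; ring

lemma exp_L {s : ℝ} (hs : 0 < s) :
    ((Real.exp (∑' p : Nat.Primes, -Real.log (1 - ((p : ℕ) : ℝ) ^ (-(1 + s)))) : ℝ) : ℂ) =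
      riemannZeta ((1 + s : ℝ) : ℂ) := by
  rw [← riemannZeta_eulerProduct_exp_log (s := ((1 + s : ℝ) : ℂ)) (by simpa using hs)]
  rw [Complex.ofReal_exp, Complex.ofReal_tsum]
  congr 1
  refine tsum_congr fun p => ?_
  have hp := two_le_p p
  have h0 : (0:ℝ) < ((p : ℕ) : ℝ) := by linarith
  have h1 : ((p : ℕ) : ℝ) ^ (-(1 + s)) ≤ 1 :=
    Real.rpow_le_one_of_one_le_of_nonpos (by linarith) (by linarith)
  rw [Complex.ofReal_neg, Complex.ofReal_log (by linarith), Complex.ofReal_sub,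
    Complex.ofReal_cpow h0.le]
  simp

lemma tendsto_L : Tendsto (fun s : ℝ => (∑' p : Nat.Primes, -Real.log (1 - ((p : ℕ) : ℝ) ^ (-(1 + s))))
    + Real.log s) (𝓝[>] 0) (𝓝 0) := by
  have h1 : Tendsto (fun s : ℝ => ((1 + s : ℝ) : ℂ)) (𝓝[>] 0) (𝓝[≠] 1) := by
    refine tendsto_nhdsWithin_iff.2 ⟨?_, ?_⟩
    · have : ContinuousAt (fun s : ℝ => ((1 + s : ℝ) : ℂ)) 0 := by fun_prop
      have := this.tendsto
      simp only [add_zero, Complex.ofReal_one] at this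
      exact this.mono_left nhdsWithin_le_nhds
    · filter_upwards [self_mem_nhdsWithin] with s hs
      have hs' : (0:ℝ) < s := hs
      simp [hs'.ne']
  have h2 := riemannZeta_residue_one.comp h1
  have h3 := (Complex.continuous_re.tendsto _).comp h2
  have h4 : Tendsto (fun s : ℝ => s * Real.exp (∑' p : Nat.Primes, -Real.log (1 - ((p : ℕ) : ℝ) ^ (-(1 + s)))))
      (𝓝[>] 0) (𝓝 1) := by
    refine (h3.congr' ?_)
    filter_upwards [self_mem_nhdsWithin] with s hs
    simp only [Function.comp]
    rw [← exp_L hs, ← Complex.ofReal_one, ← Complex.ofReal_sub, ← Complex.ofReal_mul, Complex.ofReal_re]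
    ring
  have h5 := ((Real.continuousAt_log one_ne_zero).tendsto).comp h4
  rw [Real.log_one] at h5
  refine h5.congr' ?_
  filter_upwards [self_mem_nhdsWithin] with s hs
  have hs' : (0:ℝ) < s := hs
  simp only [Function.comp]
  rw [Real.log_mul hs'.ne' (Real.exp_pos _).ne', Real.log_exp]
  ring

/-- grouping of primes -/
noncomputable def g (m : ℕ) : ℝ :=
  ∑ p ∈ (Nat.primesLE ⌊Real.exp (m : ℝ)⌋₊).filter (fun p : ℕ => ⌈Real.log ((p : ℕ) : ℝ)⌉₊ = m), 1 / ((p : ℝ) - 1)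

lemma ceil_le_iff {p : ℕ} (hp : 0 < p) (m : ℕ) : ⌈Real.log (p : ℝ)⌉₊ ≤ m ↔ p ≤ ⌊Real.exp m⌋₊ := by
  rw [Nat.ceil_le, Nat.le_floor_iff (Real.exp_pos _).le, Real.log_le_iff_le_exp (by exact_mod_cast hp)]

lemma sum_g (n : ℕ) : ∑ m ∈ range (n + 1), g m = S ⌊Real.exp n⌋₊ := by
  unfold S
  rw [← Finset.sum_fiberwise_of_maps_to (s := Nat.primesLE ⌊Real.exp n⌋₊) (t := range (n+1))
    (g := fun p : ℕ => ⌈Real.log (p : ℝ)⌉₊) (f := fun p : ℕ => 1 / ((p : ℝ) - 1))]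
  · refine Finset.sum_congr rfl fun m hm => ?_
    rw [Finset.mem_range] at hm
    unfold g
    refine Finset.sum_congr ?_ fun _ _ => rfl
    ext p
    simp only [Finset.mem_filter, Nat.mem_primesLE]
    constructor
    · rintro ⟨⟨h1, h2⟩, h3⟩
      exact ⟨⟨(ceil_le_iff h2.pos n).1 (by omega), h2⟩, h3⟩
    · rintro ⟨⟨h1, h2⟩, h3⟩
      exact ⟨⟨(ceil_le_iff h2.pos m).1 (by omega), h2⟩, h3⟩
  · intro p hp
    rw [Nat.mem_primesLE] at hp
    have := (ceil_le_iff hp.2.pos n).2 hp.1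
    rw [Finset.mem_range]; omega

lemma sum_inv (n : ℕ) : ∑ m ∈ range (n + 1), ((m : ℝ))⁻¹ = (harmonic n : ℝ) := by
  rw [Finset.sum_range_succ']
  simp [harmonic]

lemma hasSum_g {z : ℝ} {a : ℝ}
    (h : HasSum (fun p : Nat.Primes => z ^ ⌈Real.log ((p : ℕ) : ℝ)⌉₊ / (((p : ℕ) : ℝ) - 1)) a) :
    HasSum (fun m => g m * z ^ m) a := by
  have h0 : HasSum (Set.indicator (Set.ofPred Nat.Prime)
      (fun p : ℕ => z ^ ⌈Real.log (p : ℝ)⌉₊ / ((p : ℝ) - 1))) a :=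
    (hasSum_subtype_iff_indicator (s := Set.ofPred Nat.Prime)).1 h
  have h1 := h0.tsum_fiberwise (fun p : ℕ => ⌈Real.log (p : ℝ)⌉₊)
  refine hs_congr h1 fun m => ?_
  rw [_root_.tsum_subtype, tsum_eq_sum (s := (Nat.primesLE ⌊Real.exp (m : ℝ)⌋₊).filter
    (fun p : ℕ => ⌈Real.log (p : ℝ)⌉₊ = m)), g, Finset.sum_mul]
  · refine Finset.sum_congr rfl fun p hp => ?_
    simp only [Finset.mem_filter, Nat.mem_primesLE] at hp
    rw [Set.indicator_of_mem (by simpa using hp.2), Set.indicator_of_mem (by simpa using hp.1.2), hp.2]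
    ring
  · intro p hp
    by_cases hm : ⌈Real.log (p : ℝ)⌉₊ = m
    · rw [Set.indicator_of_mem (by simpa using hm), Set.indicator_of_notMem]
      intro hpp
      have hpp : p.Prime := hpp
      apply hp
      simp only [Finset.mem_filter, Nat.mem_primesLE]
      exact ⟨⟨(ceil_le_iff hpp.pos m).1 hm.le, hpp⟩, hm⟩
    · rw [Set.indicator_of_notMem (by simpa using hm)]

lemma tendsto_partial {M K : ℝ}
    (hM : ∀ n : ℕ, 2 ≤ n → |S n - Real.log (Real.log n) - M| ≤ K / Real.log n) :
    Tendsto (fun n => ∑ m ∈ range n, (g m - ((m : ℝ))⁻¹)) atTop (𝓝 (M - Real.eulerMascheroniConstant)) := by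
  rw [← tendsto_add_atTop_iff_nat 1]
  have hlog : Tendsto (fun n : ℕ => Real.log ((n : ℕ) : ℝ)) atTop atTop :=
    Real.tendsto_log_atTop.comp tendsto_natCast_atTop_atTop
  have h1 : Tendsto (fun n : ℕ => S n - Real.log (Real.log n)) atTop (𝓝 M) := by
    rw [tendsto_iff_dist_tendsto_zero]
    refine squeeze_zero' (Eventually.of_forall fun _ => dist_nonneg) ?_ (hlog.const_div_atTop K)
    filter_upwards [eventually_ge_atTop 2] with n hn
    rw [Real.dist_eq]
    exact hM n hn
  have hk : Tendsto (fun n : ℕ => ⌊Real.exp (n : ℝ)⌋₊) atTop atTop :=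
    tendsto_nat_floor_atTop.comp (Real.tendsto_exp_atTop.comp tendsto_natCast_atTop_atTop)
  have h2 := h1.comp hk
  have h3 : Tendsto (fun n : ℕ => Real.log (Real.log (⌊Real.exp (n : ℝ)⌋₊ : ℝ) / n)) atTop (𝓝 0) := by
    rw [← Real.log_one]
    refine (Real.continuousAt_log one_ne_zero).tendsto.comp ?_
    have hlow : Tendsto (fun n : ℕ => 1 - 1 / (n : ℝ)) atTop (𝓝 1) := by
      simpa using (tendsto_one_div_atTop_nhds_zero_nat (𝕜 := ℝ)).const_sub 1
    refine tendsto_of_tendsto_of_tendsto_of_le_of_le' hlow tendsto_const_nhds ?_ ?_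
    · filter_upwards [eventually_ge_atTop 1] with n hn
      have hn' : (1 : ℝ) ≤ n := by exact_mod_cast hn
      rw [le_div_iff₀ (by linarith)]
      have e1 : (1 - 1 / (n : ℝ)) * n = n - 1 := by field_simp
      rw [e1, Real.le_log_iff_exp_le]
      · have hf := Nat.lt_floor_add_one (Real.exp (n : ℝ))
        have he : Real.exp (n : ℝ) = Real.exp (n - 1) * Real.exp 1 := by
          rw [← Real.exp_add]; ring_nf
        have he1 : 2 ≤ Real.exp 1 := by have := Real.add_one_le_exp 1; linarith
        have he2 : 1 ≤ Real.exp ((n : ℝ) - 1) := Real.one_le_exp (by linarith)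
        nlinarith
      · have : 1 ≤ ⌊Real.exp (n : ℝ)⌋₊ := Nat.le_floor (by
          simpa using Real.one_le_exp (by linarith : (0:ℝ) ≤ n))
        exact_mod_cast this
    · filter_upwards [eventually_ge_atTop 1] with n hn
      have hn' : (1 : ℝ) ≤ n := by exact_mod_cast hn
      have : 1 ≤ ⌊Real.exp (n : ℝ)⌋₊ := Nat.le_floor (by
          simpa using Real.one_le_exp (by linarith : (0:ℝ) ≤ n))
      rw [div_le_one (by linarith), Real.log_le_iff_le_exp (by exact_mod_cast this)]
      exact Nat.floor_le (Real.exp_pos _).le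
  have h4 := (h2.add h3).sub Real.tendsto_harmonic_sub_log
  rw [add_zero] at h4
  refine h4.congr' ?_
  filter_upwards [eventually_ge_atTop 2] with n hn
  rw [Finset.sum_sub_distrib, sum_g, sum_inv]
  have hn' : (2 : ℝ) ≤ n := by exact_mod_cast hn
  have h5 : 2 ≤ ⌊Real.exp (n : ℝ)⌋₊ := Nat.le_floor (by
    have := Real.add_one_le_exp (n : ℝ)
    push_cast; linarith)
  have h6 : 0 < Real.log (⌊Real.exp (n : ℝ)⌋₊ : ℝ) :=
    Real.log_pos (by exact_mod_cast (by omega : 1 < ⌊Real.exp (n : ℝ)⌋₊))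
  simp only [Function.comp]
  rw [Real.log_div h6.ne' (by linarith)]
  ring

lemma const_eq {M K : ℝ}
    (hM : ∀ n : ℕ, 2 ≤ n → |S n - Real.log (Real.log n) - M| ≤ K / Real.log n) :
    M = Real.eulerMascheroniConstant + ∑' p, e 0 p := by
  have hA := Real.tendsto_tsum_powerSeries_nhdsWithin_lt (tendsto_partial hM)
  have hz : Tendsto (fun s : ℝ => Real.exp (-s)) (𝓝[>] 0) (𝓝[<] 1) := by
    refine tendsto_nhdsWithin_iff.2 ⟨?_, ?_⟩
    · have : ContinuousAt (fun s : ℝ => Real.exp (-s)) 0 := by fun_prop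
      have := this.tendsto
      simp only [neg_zero, Real.exp_zero] at this
      exact this.mono_left nhdsWithin_le_nhds
    · filter_upwards [self_mem_nhdsWithin] with s hs
      have hs' : (0:ℝ) < s := hs
      simpa using hs'
  have hB := hA.comp hz
  set L : ℝ → ℝ := fun s => ∑' p : Nat.Primes, -Real.log (1 - ((p : ℕ) : ℝ) ^ (-(1 + s))) with hL
  set E : ℝ → ℝ := fun s => ∑' p, e s p with hE
  set P : ℝ → ℝ := fun s => ∑' p : Nat.Primes, ((p : ℕ) : ℝ) ^ (-s) / (((p : ℕ) : ℝ) - 1) with hP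
  set G : ℝ → ℝ := fun s => ∑' p : Nat.Primes,
    Real.exp (-s) ^ ⌈Real.log ((p : ℕ) : ℝ)⌉₊ / (((p : ℕ) : ℝ) - 1) with hG
  have hLt : Tendsto (fun s => L s + Real.log s) (𝓝[>] 0) (𝓝 0) := tendsto_L
  have hEt : Tendsto E (𝓝[>] 0) (𝓝 (E 0)) := tendsto_E
  have hid : Tendsto (fun s : ℝ => s) (𝓝[>] 0) (𝓝 0) := tendsto_id.mono_left nhdsWithin_le_nhds
  have hPeq : ∀ s, 0 < s → P s = L s + E s := fun s hs => P_eq hs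
  -- termwise comparison
  have hcmp : ∀ s, 0 < s → ∀ p : Nat.Primes,
      Real.exp (-s) * (((p : ℕ) : ℝ) ^ (-s) / (((p : ℕ) : ℝ) - 1)) ≤
        Real.exp (-s) ^ ⌈Real.log ((p : ℕ) : ℝ)⌉₊ / (((p : ℕ) : ℝ) - 1) ∧
      Real.exp (-s) ^ ⌈Real.log ((p : ℕ) : ℝ)⌉₊ / (((p : ℕ) : ℝ) - 1) ≤
        ((p : ℕ) : ℝ) ^ (-s) / (((p : ℕ) : ℝ) - 1) := by
    intro s hs p
    have hp := two_le_p p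
    have hl0 : 0 ≤ Real.log ((p : ℕ) : ℝ) := Real.log_nonneg (by linarith)
    have hc1 := Nat.le_ceil (Real.log ((p : ℕ) : ℝ))
    have hc2 := Nat.ceil_lt_add_one hl0
    rw [← mul_div_assoc, ← Real.exp_nat_mul, Real.rpow_def_of_pos (by linarith), ← Real.exp_add]
    constructor
    · apply div_le_div_of_nonneg_right _ (by linarith)
      apply Real.exp_le_exp.2
      nlinarith
    · apply div_le_div_of_nonneg_right _ (by linarith)
      apply Real.exp_le_exp.2
      nlinarith
  have hGs : ∀ s, 0 < s → Summable (fun p : Nat.Primes =>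
      Real.exp (-s) ^ ⌈Real.log ((p : ℕ) : ℝ)⌉₊ / (((p : ℕ) : ℝ) - 1)) := fun s hs =>
    Summable.of_nonneg_of_le (fun p => by
      have := two_le_p p
      exact div_nonneg (by positivity) (by linarith)) (fun p => (hcmp s hs p).2) (summable_P hs)
  have hGP : ∀ s, 0 < s → G s ≤ P s := fun s hs =>
    (hGs s hs).tsum_le_tsum (fun p => (hcmp s hs p).2) (summable_P hs)
  have hPG : ∀ s, 0 < s → Real.exp (-s) * P s ≤ G s := fun s hs => by
    simp only [hP, hG]
    rw [← tsum_mul_left]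
    exact ((summable_P hs).mul_left _).tsum_le_tsum (fun p => (hcmp s hs p).1) (hGs s hs)
  have hP0 : ∀ s, 0 < s → 0 ≤ P s := fun s hs => tsum_nonneg fun p => by
    have := two_le_p p
    exact div_nonneg (by positivity) (by linarith)
  have hsP : Tendsto (fun s => s * P s) (𝓝[>] 0) (𝓝 0) := by
    have h1 : Tendsto (fun s => s * (L s + Real.log s) - Real.log s * s + s * E s) (𝓝[>] 0) (𝓝 0) := by
      have hls : Tendsto (fun s : ℝ => Real.log s * s) (𝓝[>] 0) (𝓝 0) := by
        simpa using tendsto_log_mul_rpow_nhdsGT_zero (r := 1) one_pos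
      simpa using ((hid.mul hLt).sub hls).add (hid.mul hEt)
    refine h1.congr' ?_
    filter_upwards [self_mem_nhdsWithin] with s hs
    rw [hPeq s hs]; ring
  have hdiff : Tendsto (fun s => P s - G s) (𝓝[>] 0) (𝓝 0) := by
    refine squeeze_zero' ?_ ?_ hsP
    · filter_upwards [self_mem_nhdsWithin] with s hs
      exact sub_nonneg.2 (hGP s hs)
    · filter_upwards [self_mem_nhdsWithin] with s hs
      have h1 := hPG s hs
      have h2 := Real.add_one_le_exp (-s)
      have h3 := hP0 s hs
      nlinarith
  have hratio : Tendsto (fun s : ℝ => Real.log ((1 - Real.exp (-s)) / s)) (𝓝[>] 0) (𝓝 0) := by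
    have hl1 := (Real.continuousAt_log one_ne_zero).tendsto
    rw [Real.log_one] at hl1
    refine hl1.comp ?_
    have hlow : Tendsto (fun s : ℝ => 1 / (1 + s)) (𝓝[>] 0) (𝓝 1) := by
      have hc : ContinuousAt (fun s : ℝ => 1 / (1 + s)) 0 :=
        ContinuousAt.div (by fun_prop) (by fun_prop) (by norm_num)
      have hc2 := hc.tendsto
      simp only [add_zero, div_one] at hc2
      exact hc2.mono_left nhdsWithin_le_nhds
    refine tendsto_of_tendsto_of_tendsto_of_le_of_le' hlow tendsto_const_nhds ?_ ?_
    · filter_upwards [self_mem_nhdsWithin] with s hs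
      have hs' : (0:ℝ) < s := hs
      have h1 : Real.exp (-s) ≤ 1 / (1 + s) := by
        rw [Real.exp_neg, ← one_div]
        apply one_div_le_one_div_of_le (by linarith)
        linarith [Real.add_one_le_exp s]
      rw [le_div_iff₀ hs']
      have : 1 / (1 + s) * s = 1 - 1 / (1 + s) := by field_simp; ring
      linarith
    · filter_upwards [self_mem_nhdsWithin] with s hs
      have hs' : (0:ℝ) < s := hs
      rw [div_le_one hs']
      linarith [Real.add_one_le_exp (-s)]
  have hC : Tendsto (fun s => -(P s - G s) + (L s + Real.log s) + E s +
      Real.log ((1 - Real.exp (-s)) / s)) (𝓝[>] 0) (𝓝 (E 0)) := by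
    simpa using ((hdiff.neg.add hLt).add hEt).add hratio
  have hfin : (fun s => -(P s - G s) + (L s + Real.log s) + E s +
      Real.log ((1 - Real.exp (-s)) / s)) =ᶠ[𝓝[>] 0]
      ((fun x => ∑' n, (g n - ((n : ℝ))⁻¹) * x ^ n) ∘ fun s => Real.exp (-s)) := by
    filter_upwards [self_mem_nhdsWithin] with s hs
    have hs' : (0:ℝ) < s := hs
    have hz1 : Real.exp (-s) < 1 := by simpa using hs'
    have hz0 := Real.exp_pos (-s)
    simp only [Function.comp]
    set z := Real.exp (-s) with hzdef
    have hg := hasSum_g (hGs s hs).hasSum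
    have hl := Real.hasSum_pow_div_log_of_abs_lt_one (x := z) (by rw [abs_of_pos hz0]; exact hz1)
    have hl2 : HasSum (fun n : ℕ => ((n : ℝ))⁻¹ * z ^ n) (-Real.log (1 - z)) := by
      rw [← hasSum_nat_add_iff' 1]
      simp only [Finset.sum_range_one, Nat.cast_zero, inv_zero, zero_mul, sub_zero]
      refine hs_congr hl fun n => ?_
      push_cast
      ring
    have hsub := hg.sub hl2
    have hsub2 : HasSum (fun n : ℕ => (g n - ((n : ℝ))⁻¹) * z ^ n) (G s - -Real.log (1 - z)) := by
      refine hs_congr hsub fun n => ?_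
      ring
    rw [hsub2.tsum_eq, Real.log_div (by linarith) hs'.ne', hPeq s hs]
    ring
  have := tendsto_nhds_unique (hC.congr' hfin) hB
  simp only [hE] at this
  linarith


lemma S_nonneg (n : ℕ) : 0 ≤ S n := by
  refine Finset.sum_nonneg fun p hp => ?_
  have h2 : (2:ℝ) ≤ p := by exact_mod_cast (Nat.mem_primesLE.1 hp).2.two_le
  exact div_nonneg zero_le_one (by linarith)

lemma S_le (n : ℕ) : S n ≤ n := by
  have hsub : Nat.primesLE n ⊆ Finset.Icc 1 n := fun p hp => by
    rw [Nat.mem_primesLE] at hp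
    exact Finset.mem_Icc.2 ⟨hp.2.one_lt.le, hp.1⟩
  have hc := Finset.card_le_card hsub
  rw [Nat.card_Icc] at hc
  have : S n ≤ (Nat.primesLE n).card • (1:ℝ) := by
    refine Finset.sum_le_card_nsmul _ _ _ fun p hp => ?_
    have h2 : (2:ℝ) ≤ p := by exact_mod_cast (Nat.mem_primesLE.1 hp).2.two_le
    rw [div_le_one (by linarith)]; linarith
  rw [nsmul_eq_mul, mul_one] at this
  refine this.trans ?_
  exact_mod_cast (by omega)

lemma assemble (Bs : ℕ → ℝ) {M K C : ℝ} {N₀ : ℕ} (hK : 0 < K) (hC : 0 < C)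
    (hM : ∀ n : ℕ, 2 ≤ n → |S n - Real.log (Real.log n) - M| ≤ K / Real.log n)
    (hB : ∀ N : ℕ, N₀ ≤ N → |Bs N - N * S (Nat.sqrt N)| ≤ C * N / Real.log N) :
    ∃ c > (0 : ℝ), ∃ x₀ : ℝ, 3 ≤ x₀ ∧ ∀ x ≥ x₀,
      |Bs ⌊x⌋₊ - (x * Real.log (Real.log x / 2) + M * x)| ≤ c * x / Real.log x := by
  refine ⟨2 * C + 2 + 4 * K + 4, by positivity, max 16 (N₀ + 1), le_trans (by norm_num) (le_max_left _ _), ?_⟩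
  intro x hx
  have hx16 : (16:ℝ) ≤ x := (le_max_left _ _).trans hx
  have hxN : (N₀:ℝ) + 1 ≤ x := (le_max_right _ _).trans hx
  have hx0 : 0 < x := by linarith
  set N := ⌊x⌋₊ with hN
  set n := Nat.sqrt N with hn
  set r := Real.sqrt x with hr
  have hr2 : r * r = x := Real.mul_self_sqrt hx0.le
  have hr4 : 4 ≤ r := by
    rw [hr]; apply Real.le_sqrt_of_sq_le; linarith
  have hNx : (N:ℝ) ≤ x := Nat.floor_le hx0.le
  have hxN1 : x < N + 1 := Nat.lt_floor_add_one x
  have hNr : r ≤ N := by nlinarith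
  have hN0 : N₀ ≤ N := Nat.le_floor (by linarith)
  have hnn : (n:ℝ) * n ≤ N := by exact_mod_cast Nat.sqrt_le N
  have hn1 : x < ((n:ℝ) + 1) * (n + 1) := by
    have : N + 1 ≤ (n + 1) * (n + 1) := Nat.succ_le_of_lt (Nat.lt_succ_sqrt N)
    have h' : ((N:ℝ) + 1) ≤ (n + 1) * (n + 1) := by exact_mod_cast this
    linarith
  have hnr : (n:ℝ) ≤ r := by
    by_contra h
    push Not at h
    nlinarith
  have hrn : r < n + 1 := by
    by_contra h
    push Not at h
    have : (0:ℝ) ≤ n := Nat.cast_nonneg n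
    nlinarith
  have hn2 : 2 ≤ n := by
    have : (3:ℝ) < n + 1 := by linarith
    have : 3 < n + 1 := by exact_mod_cast this
    omega
  have hn2' : (2:ℝ) ≤ n := by exact_mod_cast hn2
  have hlx : Real.log x = 2 * Real.log r := by
    rw [← hr2, Real.log_mul (by linarith) (by linarith)]; ring
  have hrn2 : r ≤ n * n := by nlinarith
  have hlr0 : 0 < Real.log r := Real.log_pos (by linarith)
  have hlx0 : 0 < Real.log x := by linarith
  have hlN : Real.log x / 2 ≤ Real.log N := by
    have := Real.log_le_log (by linarith) hNr
    linarith
  have hln : Real.log x / 4 ≤ Real.log n := by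
    have := Real.log_le_log (by linarith) hrn2
    rw [Real.log_mul (by linarith) (by linarith)] at this
    linarith
  have hln0 : 0 < Real.log n := by linarith
  have hinv : 1 / Real.log n ≤ 4 / Real.log x := by
    rw [div_le_div_iff₀ hln0 hlx0]; linarith
  -- pieces
  have h1 : |Bs N - N * S n| ≤ 2 * C * x / Real.log x := by
    refine (hB N hN0).trans ?_
    rw [div_le_div_iff₀ (by linarith) hlx0]
    have e1 : C * N * Real.log x ≤ C * x * Real.log x := by gcongr
    have e2 : C * x * Real.log x ≤ C * x * (2 * Real.log N) := by
      gcongr; linarith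
    linarith
  have h2 : |(N:ℝ) * S n - x * S n| ≤ 2 * x / Real.log x := by
    have e1 : |(N:ℝ) * S n - x * S n| ≤ r := by
      rw [← sub_mul, abs_mul, abs_of_nonneg (S_nonneg n)]
      have : |(N:ℝ) - x| ≤ 1 := by rw [abs_le]; constructor <;> linarith
      have := S_le n
      have := S_nonneg n
      nlinarith
    refine e1.trans ?_
    rw [le_div_iff₀ hlx0, hlx]
    have := Real.log_le_sub_one_of_pos (show 0 < r by linarith)
    nlinarith
  have h3 : |x * S n - x * (Real.log (Real.log n) + M)| ≤ 4 * K * x / Real.log x := by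
    rw [← mul_sub, abs_mul, abs_of_pos hx0]
    have e1 := hM n hn2
    have e2 : K / Real.log n ≤ K * (4 / Real.log x) := by
      rw [div_eq_mul_one_div]; gcongr
    calc x * |S n - (Real.log (Real.log n) + M)| ≤ x * (K * (4 / Real.log x)) := by
          rw [← sub_sub]; gcongr; exact e1.trans e2
      _ = _ := by ring
  have h4 : |x * (Real.log (Real.log n) + M) - (x * Real.log (Real.log x / 2) + M * x)|
      ≤ 4 * x / Real.log x := by
    have hhalf : Real.log x / 2 = Real.log r := by linarith
    have e0 : x * (Real.log (Real.log n) + M) - (x * Real.log (Real.log x / 2) + M * x)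
      = - (x * (Real.log (Real.log r) - Real.log (Real.log n))) := by rw [hhalf]; ring
    have hle : Real.log n ≤ Real.log r := Real.log_le_log (by linarith) hnr
    have e1 : 0 ≤ Real.log (Real.log r) - Real.log (Real.log n) :=
      sub_nonneg.2 (Real.log_le_log hln0 hle)
    have e2 : Real.log r - Real.log n ≤ 1 := by
      rw [← Real.log_div (by linarith) (by linarith)]
      have := Real.log_le_sub_one_of_pos (show 0 < r / n by positivity)
      have h5 : r / n ≤ 2 := by rw [div_le_iff₀ (by linarith)]; linarith
      linarith
    have e3 : Real.log (Real.log r) - Real.log (Real.log n) ≤ 1 / Real.log n := by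
      rw [← Real.log_div hlr0.ne' hln0.ne']
      have := Real.log_le_sub_one_of_pos (div_pos hlr0 hln0)
      have h5 : Real.log r / Real.log n - 1 = (Real.log r - Real.log n) / Real.log n := by
        field_simp
      have h6 : (Real.log r - Real.log n) / Real.log n ≤ 1 / Real.log n := by gcongr
      linarith
    rw [e0, abs_neg, abs_mul, abs_of_pos hx0, abs_of_nonneg e1]
    calc x * (Real.log (Real.log r) - Real.log (Real.log n)) ≤ x * (4 / Real.log x) := by
          gcongr; exact e3.trans hinv
      _ = _ := by ring
  have t1 := abs_sub_le (Bs N) (N * S n) (x * Real.log (Real.log x / 2) + M * x)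
  have t2 := abs_sub_le (N * S n) (x * S n) (x * Real.log (Real.log x / 2) + M * x)
  have t3 := abs_sub_le (x * S n) (x * (Real.log (Real.log n) + M))
    (x * Real.log (Real.log x / 2) + M * x)
  have : (2 * C + 2 + 4 * K + 4) * x / Real.log x = 2 * C * x / Real.log x + 2 * x / Real.log x
    + 4 * K * x / Real.log x + 4 * x / Real.log x := by ring
  linarith

end Stmt17

/-- **Mean value of `B(n) = A(n) − A*(n)`** (Theorem `th:B_1`), where
`A(n) = Σ_{p^ν ∥ n} ν p` and `A*(n) = Σ_{p ∣ n} p` are the Alladi–Erdős functions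
(here `ν = n.factorization p`). Then
`Σ_{n ≤ x} B(n) = x log log √x + F x + O(x/log x)`, where
`F = γ + Σ_p (log(1 − 1/p) + 1/(p−1))` (absolutely convergent sum over primes)
and `log log √x = log((log x)/2)`. -/
theorem stmt_17 :
    Summable (fun p : Nat.Primes =>
      |Real.log (1 - 1 / ((p : ℕ) : ℝ)) + 1 / (((p : ℕ) : ℝ) - 1)|) ∧
    ∃ c > (0 : ℝ), ∃ x₀ : ℝ, 3 ≤ x₀ ∧ ∀ x ≥ x₀,
      |(∑ n ∈ Finset.Icc 1 ⌊x⌋₊,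
          ((∑ p ∈ n.primeFactors, (n.factorization p : ℝ) * (p : ℝ)) -
            ∑ p ∈ n.primeFactors, (p : ℝ))) -
        (x * Real.log (Real.log x / 2) +
          (Real.eulerMascheroniConstant +
            ∑' p : Nat.Primes,
              (Real.log (1 - 1 / ((p : ℕ) : ℝ)) + 1 / (((p : ℕ) : ℝ) - 1))) * x)| ≤
        c * x / Real.log x := by
  refine ⟨?_, ?_⟩
  · refine (Stmt17.summable_e (s := 0) le_rfl).abs.congr fun p => ?_
    rw [Stmt17.e_zero]
  · obtain ⟨M, K, hK, hM⟩ := Stmt17.mertens2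
    obtain ⟨C, hC, N₀, hB⟩ := Stmt17.sumB_approx
    have hF := Stmt17.const_eq hM
    rw [tsum_congr Stmt17.e_zero] at hF
    rw [← hF]
    exact Stmt17.assemble (fun N => ∑ n ∈ Finset.Icc 1 N,
          ((∑ p ∈ n.primeFactors, (n.factorization p : ℝ) * (p : ℝ)) -
            ∑ p ∈ n.primeFactors, (p : ℝ))) hK hC hM hB
end

section
/- Let B(n) = A(n) − A*(n), where A(n) = Σ_{p^ν || n} ν·p and A*(n) = Σ_{p | n} p, and let k ≥ 2 be a fixed integer. Then Σ_{n₁,…,n_k ≤ x} B(gcd(n₁,…,n_k)) = x^k · Σ_p 1/( p^{k−1}·(p^k − 1) ) + R(x), where the constant sum ranges over all primes (and converges absolutely), and where R(x) = O(x^{k−1}) as x → ∞ if k ≥ 3, and R(x) = O(x·log log x) as x → ∞ if k = 2. -/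
lemma B_eq (N g : ℕ) (hg : g ≠ 0) (hgN : g ≤ N) :
    (∑ p ∈ g.primeFactors, (g.factorization p : ℝ) * (p : ℝ)) - ∑ p ∈ g.primeFactors, (p : ℝ)
    = ∑ p ∈ (Finset.range (N+1)).filter Nat.Prime, ∑ ν ∈ Finset.range N,
        (if p ^ (ν + 2) ∣ g then (p : ℝ) else 0) := by
  rw [← Finset.sum_sub_distrib]
  have hsub : g.primeFactors ⊆ (Finset.range (N+1)).filter Nat.Prime := by
    intro p hp
    have h1 := Nat.prime_of_mem_primeFactors hp
    have h2 := Nat.le_of_dvd (Nat.pos_of_ne_zero hg) (Nat.dvd_of_mem_primeFactors hp)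
    simp only [Finset.mem_filter, Finset.mem_range]
    exact ⟨by omega, h1⟩
  rw [← Finset.sum_subset hsub]
  · apply Finset.sum_congr rfl
    intro p hp
    have h1 := Nat.prime_of_mem_primeFactors hp
    have h3 : 1 ≤ g.factorization p :=
      h1.factorization_pos_of_dvd hg (Nat.dvd_of_mem_primeFactors hp)
    have h4 : g.factorization p < g := Nat.factorization_lt p hg
    rw [← Finset.sum_filter, Finset.sum_const, nsmul_eq_mul]
    have : (Finset.range N).filter (fun ν => p ^ (ν + 2) ∣ g)
        = Finset.range (g.factorization p - 1) := by
      ext ν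
      simp only [Finset.mem_filter, Finset.mem_range, h1.pow_dvd_iff_le_factorization hg]
      omega
    rw [this, Finset.card_range, Nat.cast_sub h3]
    push_cast
    ring
  · intro p hp hpn
    apply Finset.sum_eq_zero
    intro ν _
    rw [if_neg]
    intro hd
    apply hpn
    rw [Nat.mem_primeFactors]
    exact ⟨(Finset.mem_filter.1 hp).2, (dvd_pow_self p (by omega)).trans hd, hg⟩

lemma count_eq (k N d : ℕ) :
    ((Fintype.piFinset (fun _ : Fin k => Finset.Icc 1 N)).filter
      (fun n => d ∣ Finset.univ.gcd n)).card = (N / d) ^ k := by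
  have : ((Fintype.piFinset (fun _ : Fin k => Finset.Icc 1 N)).filter
      (fun n => d ∣ Finset.univ.gcd n)) =
      Fintype.piFinset (fun _ : Fin k => (Finset.Ioc 0 N).filter (fun m => d ∣ m)) := by
    ext n
    simp only [Finset.mem_filter, Fintype.mem_piFinset, Finset.dvd_gcd_iff, Finset.mem_Icc,
      Finset.mem_Ioc, Finset.mem_univ, true_implies, forall_and, Nat.succ_le_iff]
  rw [this, Fintype.card_piFinset]
  simp [Nat.Ioc_filter_dvd_card_eq_div]

lemma gcd_sum_eq (k N : ℕ) (hk : 2 ≤ k) :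
    (∑ n ∈ Fintype.piFinset (fun _ : Fin k => Finset.Icc 1 N),
            ((∑ p ∈ (Finset.univ.gcd n).primeFactors,
                ((Finset.univ.gcd n).factorization p : ℝ) * (p : ℝ)) -
              ∑ p ∈ (Finset.univ.gcd n).primeFactors, (p : ℝ)))
    = ∑ p ∈ (Finset.range (N+1)).filter Nat.Prime, (p:ℝ) * ∑ ν ∈ Finset.range N,
        (((N / p ^ (ν + 2) : ℕ) : ℝ)) ^ k := by
  have h1 : ∀ n ∈ Fintype.piFinset (fun _ : Fin k => Finset.Icc 1 N),
      Finset.univ.gcd n ≠ 0 ∧ Finset.univ.gcd n ≤ N := by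
    intro n hn
    rw [Fintype.mem_piFinset] at hn
    have h0 := Finset.mem_Icc.1 (hn ⟨0, by omega⟩)
    have hd : Finset.univ.gcd n ∣ n ⟨0, by omega⟩ := Finset.gcd_dvd (Finset.mem_univ _)
    have := Nat.le_of_dvd (by omega) hd
    refine ⟨?_, by omega⟩
    intro h
    rw [h, zero_dvd_iff] at hd
    omega
  rw [Finset.sum_congr rfl (fun n hn => B_eq N _ (h1 n hn).1 (h1 n hn).2), Finset.sum_comm]
  apply Finset.sum_congr rfl
  intro p _
  rw [Finset.sum_comm, Finset.mul_sum]
  apply Finset.sum_congr rfl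
  intro ν _
  rw [← Finset.sum_filter, Finset.sum_const, count_eq, nsmul_eq_mul]
  push_cast
  ring

/-- error at one t -/
lemma floor_err (t : ℝ) (ht : 0 ≤ t) (k : ℕ) :
    0 ≤ t ^ k - (⌊t⌋₊ : ℝ) ^ k ∧ t ^ k - (⌊t⌋₊ : ℝ) ^ k ≤ k * t ^ (k - 1) := by
  have h1 := Nat.floor_le ht
  have h2 := Nat.lt_floor_add_one t
  have h0 : (0:ℝ) ≤ (⌊t⌋₊ : ℝ) := Nat.cast_nonneg _
  constructor
  · have := pow_le_pow_left₀ h0 h1 k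
    linarith
  · have := (le_abs_self _).trans (abs_pow_sub_pow_le t (⌊t⌋₊ : ℝ) k)
    rw [abs_of_nonneg ht, abs_of_nonneg h0, max_eq_left h1, abs_of_nonneg (by linarith)] at this
    refine this.trans ?_
    have h3 : 0 ≤ (k:ℝ) * t ^ (k-1) := by positivity
    nlinarith

lemma geo (p : ℕ) (hp : 2 ≤ p) (x : ℝ) (m : ℕ) (hm : 1 ≤ m) :
    HasSum (fun ν : ℕ => (x / (p:ℝ) ^ (ν + 2)) ^ m)
      (x ^ m * (1 / ((p:ℝ) ^ m * ((p:ℝ)^m - 1)))) := by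
  have hp' : (2:ℝ) ≤ p := by exact_mod_cast hp
  have hpm : (1:ℝ) < (p:ℝ)^m := one_lt_pow₀ (by linarith) (by omega)
  have h := (hasSum_geometric_of_lt_one (r := ((p:ℝ)^m)⁻¹) (by positivity)
    (inv_lt_one_of_one_lt₀ hpm)).mul_left (x ^ m / ((p:ℝ)^m)^2)
  have e1 : (fun ν : ℕ => (x / (p:ℝ) ^ (ν + 2)) ^ m) =
      fun i => x ^ m / ((p:ℝ)^m)^2 * ((p:ℝ)^m)⁻¹ ^ i := by
    funext ν
    have h0 : (p:ℝ) ≠ 0 := by linarith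
    rw [div_pow, inv_pow, ← pow_mul, ← pow_mul, ← pow_mul, ← div_eq_mul_inv, div_div, ← pow_add]
    congr 2
    ring
  have e2 : x ^ m * (1 / ((p:ℝ) ^ m * ((p:ℝ)^m - 1))) =
      x ^ m / ((p:ℝ)^m)^2 * (1 - ((p:ℝ)^m)⁻¹)⁻¹ := by
    have h1 : (p:ℝ)^m - 1 ≠ 0 := by linarith
    have h2 : (p:ℝ)^m ≠ 0 := by linarith
    have h3 : 1 - ((p:ℝ)^m)⁻¹ = ((p:ℝ)^m - 1) / (p:ℝ)^m := by field_simp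
    rw [h3]
    field_simp
  rw [e1, e2]
  exact h

/-- error at prime p -/
lemma err_p (p k : ℕ) (hp : 2 ≤ p) (hk : 2 ≤ k) (x : ℝ) (hx : 0 ≤ x) :
    let E := x ^ k * (1 / ((p:ℝ) ^ (k-1) * ((p:ℝ)^k - 1))) - (p:ℝ) * ∑ ν ∈ Finset.range ⌊x⌋₊,
        (((⌊x⌋₊ / p ^ (ν + 2) : ℕ) : ℝ)) ^ k
    0 ≤ E ∧ E ≤ p * (k * (x ^ (k-1) * (1 / ((p:ℝ) ^ (k-1) * ((p:ℝ)^(k-1) - 1))))) := by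
  intro E
  have hp' : (2:ℝ) ≤ p := by exact_mod_cast hp
  have hpm : (1:ℝ) < (p:ℝ)^k := one_lt_pow₀ (by linarith) (by omega)
  have h1 := geo p hp x k (by omega)
  have h2 := geo p hp x (k-1) (by omega)
  have h3 : HasSum (fun ν : ℕ => (((⌊x⌋₊ / p ^ (ν + 2) : ℕ) : ℝ)) ^ k)
      (∑ ν ∈ Finset.range ⌊x⌋₊, (((⌊x⌋₊ / p ^ (ν + 2) : ℕ) : ℝ)) ^ k) := by
    apply hasSum_sum_of_ne_finset_zero
    intro ν hν
    have hν' : ⌊x⌋₊ ≤ ν := by simpa using hν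
    have : ν + 2 < p ^ (ν+2) := Nat.lt_pow_self (by omega)
    rw [Nat.div_eq_of_lt (by omega)]
    simp; omega
  have hf : ∀ ν : ℕ, (((⌊x⌋₊ / p ^ (ν + 2) : ℕ) : ℝ)) = (⌊x / (p:ℝ)^(ν+2)⌋₊ : ℝ) := by
    intro ν
    rw [← Nat.floor_div_natCast]
    push_cast
    rfl
  have hE : HasSum (fun ν : ℕ => (p:ℝ) * ((x / (p:ℝ) ^ (ν + 2)) ^ k -
      (((⌊x⌋₊ / p ^ (ν + 2) : ℕ) : ℝ)) ^ k)) E := by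
    have h5 := (h1.sub h3).mul_left (p:ℝ)
    suffices h6 : E = (p:ℝ) * (x ^ k * (1 / ((p:ℝ) ^ k * ((p:ℝ)^k - 1))) -
        ∑ ν ∈ Finset.range ⌊x⌋₊, (((⌊x⌋₊ / p ^ (ν + 2) : ℕ) : ℝ)) ^ k) by
      rw [h6]; exact h5
    simp only [E]
    rw [mul_sub]
    congr 1
    obtain ⟨j, rfl⟩ : ∃ j, k = j + 1 := ⟨k - 1, by omega⟩
    have : (p:ℝ)^(j+1) - 1 ≠ 0 := by linarith
    have : (p:ℝ) ≠ 0 := by linarith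
    simp only [Nat.add_sub_cancel]
    rw [pow_succ (p:ℝ) j] at *
    field_simp
  have hb : ∀ ν : ℕ, 0 ≤ x / (p:ℝ)^(ν+2) := fun ν => by positivity
  constructor
  · refine hE.nonneg (fun ν => ?_)
    rw [hf]
    exact mul_nonneg (by linarith) (floor_err _ (hb ν) k).1
  · refine hasSum_le (fun ν => ?_) hE ((h2.mul_left (k:ℝ)).mul_left (p:ℝ))
    rw [hf]
    exact mul_le_mul_of_nonneg_left (floor_err _ (hb ν) k).2 (by linarith)

/-- dyadic prime block -/
lemma block (j : ℕ) (hj : 1 ≤ j) :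
    ∑ p ∈ (Finset.Ico (2^j) (2^(j+1))).filter Nat.Prime, (1:ℝ) / p ≤ 4 / j := by
  set s := (Finset.Ico (2^j) (2^(j+1))).filter Nat.Prime with hs
  have h1 : (2^j) ^ s.card ≤ ∏ p ∈ s, p := by
    apply Finset.pow_card_le_prod
    intro p hp
    simp [hs] at hp
    exact hp.1.1
  have h2 : ∏ p ∈ s, p ≤ primorial (2^(j+1)) := by
    rw [primorial]
    apply Finset.prod_le_prod_of_subset_of_one_le'
    · intro p hp
      simp only [hs, Finset.mem_filter, Finset.mem_Ico] at hp
      first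
        | (rw [Nat.mem_primesLE]; exact ⟨by omega, hp.2⟩)
        | (simp only [Finset.mem_filter, Finset.mem_range]; exact ⟨by omega, hp.2⟩)
    · intro p hp _
      first
        | exact ((Nat.mem_primesLE.1 hp).2).one_lt.le
        | exact ((Finset.mem_filter.1 hp).2).one_lt.le
  have h3 := (h1.trans h2).trans (primorial_le_four_pow _)
  rw [show (4:ℕ) = 2^2 by norm_num, ← pow_mul, ← pow_mul,
    Nat.pow_le_pow_iff_right (by norm_num)] at h3
  have h4 : ∑ p ∈ s, (1:ℝ) / p ≤ s.card • ((1:ℝ) / 2^j) := by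
    apply Finset.sum_le_card_nsmul
    intro p hp
    simp only [hs, Finset.mem_filter, Finset.mem_Ico] at hp
    apply one_div_le_one_div_of_le (by positivity)
    exact_mod_cast hp.1.1
  refine h4.trans ?_
  have h5 : (j:ℝ) * s.card ≤ 2 * 2^(j+1) := by exact_mod_cast h3
  rw [nsmul_eq_mul, mul_one_div, div_le_div_iff₀ (by positivity) (by positivity)]
  rw [pow_succ] at h5
  linarith

lemma block_sum (J : ℕ) :
    ∑ p ∈ (Finset.range (2^(J+1))).filter Nat.Prime, (1:ℝ) / p ≤ 4 * (harmonic J : ℝ) := by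
  induction J with
  | zero =>
    have : (Finset.range (2^(0+1))).filter Nat.Prime = ∅ := by decide
    rw [this]; simp
  | succ J ih =>
    have hb := block (J+1) (by omega)
    have hle : 2^(J+1) ≤ 2^(J+1+1) := Nat.pow_le_pow_right (by norm_num) (by omega)
    rw [Finset.sum_filter] at *
    rw [← Finset.sum_range_add_sum_Ico _ hle, harmonic_succ]
    push_cast at *
    have : (4:ℝ) / (J+1) = 4 * ((J:ℝ)+1)⁻¹ := by ring
    linarith

lemma mertens (N : ℕ) (x : ℝ) (hx : Real.exp (Real.exp 1) ≤ x) (hN : (N:ℝ) ≤ x) :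
    ∑ p ∈ (Finset.range (N+1)).filter Nat.Prime, (1:ℝ) / p ≤ 12 * Real.log (Real.log x) := by
  have hx0 : 0 < x := (Real.exp_pos _).trans_le hx
  have hl : Real.exp 1 ≤ Real.log x := (Real.le_log_iff_exp_le hx0).2 hx
  have hl0 : 0 < Real.log x := (Real.exp_pos _).trans_le hl
  have hll : 1 ≤ Real.log (Real.log x) := (Real.le_log_iff_exp_le hl0).2 hl
  set J := Nat.log 2 N with hJ
  have h1 : N < 2^(J+1) := Nat.lt_pow_succ_log_self (by norm_num) N
  have h2 : ∑ p ∈ (Finset.range (N+1)).filter Nat.Prime, (1:ℝ) / p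
      ≤ ∑ p ∈ (Finset.range (2^(J+1))).filter Nat.Prime, (1:ℝ) / p := by
    apply Finset.sum_le_sum_of_subset_of_nonneg
    · apply Finset.filter_subset_filter
      intro a ha
      simp only [Finset.mem_range] at *
      omega
    · intros; positivity
  have h3 := h2.trans (block_sum J)
  have h4 := harmonic_le_one_add_log J
  have h5 : Real.log J ≤ 1 + Real.log (Real.log x) := by
    rcases Nat.eq_zero_or_pos J with h0 | h0
    · rw [h0]; simp; linarith
    · have hN0 : N ≠ 0 := by
        rintro rfl
        simp [hJ] at h0
      have h6 : 2^J ≤ N := Nat.pow_log_le_self 2 hN0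
      have h7 : (2:ℝ)^J ≤ x := le_trans (by exact_mod_cast h6) hN
      have h8 := Real.log_le_log (by positivity) h7
      rw [Real.log_pow] at h8
      have h9 := Real.log_two_gt_d9
      have h10 : (J:ℝ) ≤ 2 * Real.log x := by nlinarith [(Nat.cast_nonneg J : (0:ℝ) ≤ J)]
      have h11 := Real.log_le_log (by exact_mod_cast h0) h10
      rw [Real.log_mul (by norm_num) hl0.ne'] at h11
      have := Real.log_two_lt_d9
      linarith
  linarith

noncomputable def cc (k n : ℕ) : ℝ := 1 / ((n:ℝ) ^ (k-1) * ((n:ℝ)^k - 1))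

lemma half_pow (n k : ℕ) (hn : 2 ≤ n) (hk : 1 ≤ k) : (n:ℝ)^k / 2 ≤ (n:ℝ)^k - 1 := by
  have hn' : (2:ℝ) ≤ n := by exact_mod_cast hn
  have : (n:ℝ)^1 ≤ (n:ℝ)^k := pow_le_pow_right₀ (by linarith) hk
  linarith [pow_one (n:ℝ)]

lemma cc_bound (k n : ℕ) (hk : 2 ≤ k) (hn : 2 ≤ n) : 0 ≤ cc k n ∧ cc k n ≤ 2 * ((n:ℝ)^3)⁻¹ := by
  have hn' : (2:ℝ) ≤ n := by exact_mod_cast hn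
  have h := half_pow n k hn (by omega)
  have h0 : 0 < (n:ℝ)^k := by positivity
  have h0' : 0 < (n:ℝ)^(k-1) := by positivity
  have h3 : (n:ℝ)^3 ≤ (n:ℝ)^(k-1) * (n:ℝ)^k := by
    rw [← pow_add]; exact pow_le_pow_right₀ (by linarith) (by omega)
  unfold cc
  constructor
  · exact one_div_nonneg.2 (mul_nonneg h0'.le (by linarith))
  · rw [← div_eq_mul_inv, div_le_div_iff₀ (mul_pos h0' (by linarith)) (by positivity)]
    nlinarith

lemma summ (k : ℕ) (hk : 2 ≤ k) : Summable ({n : ℕ | n.Prime}.indicator (cc k)) := by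
  have h : Summable (fun n : ℕ => 2 * ((n:ℝ)^3)⁻¹) :=
    (Real.summable_nat_pow_inv.2 (by norm_num)).mul_left 2
  refine Summable.of_nonneg_of_le (fun n => ?_) (fun n => ?_) h
  · exact Set.indicator_nonneg (fun n hn => (cc_bound k n hk (Nat.Prime.two_le hn)).1) n
  · by_cases hn : n.Prime
    · rw [Set.indicator_of_mem (by exact hn)]
      exact (cc_bound k n hk hn.two_le).2
    · rw [Set.indicator_of_notMem (by exact hn)]
      positivity

noncomputable def EE (k : ℕ) (x : ℝ) (n : ℕ) : ℝ := x ^ k * cc k n -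
  (n:ℝ) * ∑ ν ∈ Finset.range ⌊x⌋₊, (((⌊x⌋₊ / n ^ (ν + 2) : ℕ) : ℝ)) ^ k

lemma EE_nonneg (k : ℕ) (hk : 2 ≤ k) (x : ℝ) (hx : 0 ≤ x) (n : ℕ) :
    0 ≤ {n : ℕ | n.Prime}.indicator (EE k x) n :=
  Set.indicator_nonneg (fun n hn => (err_p n k (Nat.Prime.two_le hn) hk x hx).1) n

lemma total (k : ℕ) (hk : 2 ≤ k) (x : ℝ) (hx : 0 ≤ x) (C : ℝ)
    (hC : ∀ M, ∑ n ∈ Finset.range M, {n : ℕ | n.Prime}.indicator (EE k x) n ≤ C) :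
    |(∑ n ∈ Fintype.piFinset (fun _ : Fin k => Finset.Icc 1 ⌊x⌋₊),
            ((∑ p ∈ (Finset.univ.gcd n).primeFactors,
                ((Finset.univ.gcd n).factorization p : ℝ) * (p : ℝ)) -
              ∑ p ∈ (Finset.univ.gcd n).primeFactors, (p : ℝ))) -
          x ^ k * ∑' p : Nat.Primes,
            1 / (((p : ℕ) : ℝ) ^ (k - 1) * (((p : ℕ) : ℝ) ^ k - 1))| ≤ C := by
  rw [gcd_sum_eq k _ hk]
  have h1 : ∑' p : Nat.Primes, 1 / (((p : ℕ) : ℝ) ^ (k - 1) * (((p : ℕ) : ℝ) ^ k - 1))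
      = ∑' n, {n : ℕ | n.Prime}.indicator (cc k) n := tsum_subtype {n : ℕ | n.Prime} (cc k)
  set G : ℕ → ℝ := fun n => (n:ℝ) * ∑ ν ∈ Finset.range ⌊x⌋₊,
    (((⌊x⌋₊ / n ^ (ν + 2) : ℕ) : ℝ)) ^ k with hG
  have h2 : HasSum ({n : ℕ | n.Prime}.indicator G)
      (∑ p ∈ (Finset.range (⌊x⌋₊+1)).filter Nat.Prime, G p) := by
    have : ∑ p ∈ (Finset.range (⌊x⌋₊+1)).filter Nat.Prime, G p
      = ∑ p ∈ Finset.range (⌊x⌋₊+1), {n : ℕ | n.Prime}.indicator G p := by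
      rw [Finset.sum_filter]
      apply Finset.sum_congr rfl
      intro p _
      simp [Set.indicator_apply]
    rw [this]
    apply hasSum_sum_of_ne_finset_zero
    intro n hn
    have hn' : ⌊x⌋₊ < n := by simp at hn; omega
    by_cases hp : n.Prime
    · rw [Set.indicator_of_mem (by exact hp)]
      simp only [hG]
      rw [Finset.sum_eq_zero, mul_zero]
      intro ν _
      have : n ^ 1 ≤ n ^ (ν+2) := Nat.pow_le_pow_right hp.pos (by omega)
      rw [pow_one] at this
      rw [Nat.div_eq_of_lt (by omega)]
      simp; omega
    · exact Set.indicator_of_notMem (by exact hp) _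
  have h3 := ((summ k hk).hasSum.mul_left (x^k)).sub h2
  have h4 : (fun n => x ^ k * {n : ℕ | n.Prime}.indicator (cc k) n -
      {n : ℕ | n.Prime}.indicator G n) = {n : ℕ | n.Prime}.indicator (EE k x) := by
    funext n
    by_cases hp : n.Prime
    · simp [Set.indicator_apply, hp, EE, hG]
    · simp [Set.indicator_apply, hp]
  rw [h4] at h3
  rw [h1, abs_sub_comm, ← h3.tsum_eq, abs_of_nonneg (tsum_nonneg (EE_nonneg k hk x hx))]
  exact Real.tsum_le_of_sum_range_le (EE_nonneg k hk x hx) hC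

lemma EE_le (k : ℕ) (hk : 2 ≤ k) (x : ℝ) (hx : 0 ≤ x) (n : ℕ) (hn : 2 ≤ n) :
    EE k x n ≤ 2 * k * x ^ (k-1) * ((n:ℝ)^(2*(k-1)-1))⁻¹ := by
  refine (err_p n k hn hk x hx).2.trans ?_
  have hn' : (2:ℝ) ≤ n := by exact_mod_cast hn
  have h := half_pow n (k-1) hn (by omega)
  obtain ⟨j, rfl⟩ : ∃ j, k = j + 2 := ⟨k - 2, by omega⟩
  have e1 : j + 2 - 1 = j + 1 := by omega
  have e2 : 2 * (j+1) - 1 = 2 * j + 1 := by omega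
  simp only [e1] at h ⊢
  rw [e2]
  have h0 : 0 < (n:ℝ)^(j+1) := by positivity
  have key : (n:ℝ) * (1 / ((n:ℝ) ^ (j+1) * ((n:ℝ)^(j+1) - 1))) ≤ 2 * ((n:ℝ)^(2*j+1))⁻¹ := by
    rw [mul_one_div, ← div_eq_mul_inv,
      div_le_div_iff₀ (mul_pos h0 (by linarith)) (by positivity)]
    have : (n:ℝ) * (n:ℝ)^(2*j+1) = (n:ℝ)^(j+1) * (n:ℝ)^(j+1) := by ring
    rw [this]
    nlinarith
  have h5 : (0:ℝ) ≤ ((j+2:ℕ):ℝ) * x^(j+1) := by positivity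
  have := mul_le_mul_of_nonneg_left key h5
  linarith

lemma case3 (k : ℕ) (hk : 3 ≤ k) (x : ℝ) (hx : 0 ≤ x) (M : ℕ) :
    ∑ n ∈ Finset.range M, {n : ℕ | n.Prime}.indicator (EE k x) n ≤ 4 * k * x^(k-1) := by
  have h1 : ∑ n ∈ Finset.range M, {n : ℕ | n.Prime}.indicator (EE k x) n ≤
      ∑ n ∈ Finset.Ioo 0 M, 2 * k * x^(k-1) * ((n:ℝ)^2)⁻¹ := by
    have hsub : Finset.Ioo 0 M ⊆ Finset.range M := by
      intro a; simp
    rw [← Finset.sum_subset hsub]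
    · apply Finset.sum_le_sum
      intro n hn
      by_cases hp : n.Prime
      · rw [Set.indicator_of_mem (by exact hp)]
        refine (EE_le k (by omega) x hx n hp.two_le).trans ?_
        apply mul_le_mul_of_nonneg_left _ (by positivity)
        have : (2:ℝ) ≤ n := by exact_mod_cast hp.two_le
        apply inv_anti₀ (by positivity)
        exact pow_le_pow_right₀ (by linarith) (by omega)
      · rw [Set.indicator_of_notMem (by exact hp)]
        positivity
    · intro n hn hn'
      have : n = 0 := by simp at hn hn'; omega
      subst this
      simp [Set.indicator_apply, Nat.not_prime_zero]
  refine h1.trans ?_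
  rw [← Finset.mul_sum]
  have h2 := sum_Ioo_inv_sq_le (α := ℝ) 0 M
  have h3 : (0:ℝ) ≤ 2 * k * x^(k-1) := by positivity
  have := mul_le_mul_of_nonneg_left h2 h3
  norm_num at this ⊢
  linarith

lemma case2 (x : ℝ) (hx : Real.exp (Real.exp 1) ≤ x) (M : ℕ) :
    ∑ n ∈ Finset.range M, {n : ℕ | n.Prime}.indicator (EE 2 x) n ≤
      52 * x * Real.log (Real.log x) := by
  have hx0 : 0 < x := (Real.exp_pos _).trans_le hx
  have hl : Real.exp 1 ≤ Real.log x := (Real.le_log_iff_exp_le hx0).2 hx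
  have hl0 : 0 < Real.log x := (Real.exp_pos _).trans_le hl
  have hll : 1 ≤ Real.log (Real.log x) := (Real.le_log_iff_exp_le hl0).2 hl
  have hx1 : 1 ≤ x := (Real.one_le_exp (Real.exp_pos _).le).trans hx
  set N := ⌊Real.sqrt x⌋₊ with hN
  have hNx : (N:ℝ) ≤ x := (Nat.floor_le (Real.sqrt_nonneg x)).trans
    (by rw [Real.sqrt_le_left hx0.le]; nlinarith)
  have hN1 : Real.sqrt x < N + 1 := Nat.lt_floor_add_one _
  have hN2 : x ≤ (N+1:ℝ)^2 := by
    rw [← Real.sq_sqrt hx0.le]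
    exact pow_le_pow_left₀ (Real.sqrt_nonneg x) hN1.le 2
  have h1 : ∀ n, {n : ℕ | n.Prime}.indicator (EE 2 x) n ≤
      4 * x * (if n ∈ (Finset.range (N+1)).filter Nat.Prime then (1:ℝ)/n else 0) +
      2 * x^2 / (N+1) * (if N < n then ((n:ℝ)^2)⁻¹ else 0) := by
    intro n
    have a1 : (0:ℝ) ≤ (if n ∈ (Finset.range (N+1)).filter Nat.Prime then (1:ℝ)/n else 0) := by
      split_ifs <;> positivity
    have a2 : (0:ℝ) ≤ (if N < n then ((n:ℝ)^2)⁻¹ else 0) := by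
      split_ifs <;> positivity
    by_cases hp : n.Prime
    · rw [Set.indicator_of_mem (by exact hp)]
      by_cases hn : N < n
      · rw [if_pos hn]
        have hn' : (N:ℝ)+1 ≤ n := by exact_mod_cast hn
        have b1 : EE 2 x n ≤ x^2 * cc 2 n := by
          unfold EE
          have : 0 ≤ (n:ℝ) * ∑ ν ∈ Finset.range ⌊x⌋₊,
            (((⌊x⌋₊ / n ^ (ν + 2) : ℕ) : ℝ)) ^ 2 := by positivity
          linarith
        have b2 := mul_le_mul_of_nonneg_left (cc_bound 2 n le_rfl hp.two_le).2 (sq_nonneg x)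
        have hnp : (0:ℝ) < n := by exact_mod_cast hp.pos
        have b3 : ((n:ℝ)^3)⁻¹ ≤ 1/(N+1) * ((n:ℝ)^2)⁻¹ := by
          rw [one_div, ← mul_inv]
          apply inv_anti₀ (by positivity)
          nlinarith [sq_nonneg (n:ℝ)]
        have b4 := mul_le_mul_of_nonneg_left b3 (by positivity : 0 ≤ 2 * x^2)
        have b5 := mul_nonneg (by positivity : 0 ≤ 4 * x) a1
        have b6 : 2 * x^2 / (N+1) * ((n:ℝ)^2)⁻¹ = 2 * x^2 * (1/(N+1) * ((n:ℝ)^2)⁻¹) := by ring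
        linarith
      · rw [if_pos (by simp [hp]; omega), if_neg hn]
        have := EE_le 2 le_rfl x hx0.le n hp.two_le
        norm_num at this ⊢
        linarith
    · rw [Set.indicator_of_notMem (by exact hp)]
      positivity
  refine (Finset.sum_le_sum (fun n _ => h1 n)).trans ?_
  rw [Finset.sum_add_distrib, ← Finset.mul_sum, ← Finset.mul_sum]
  have c1 : ∑ n ∈ Finset.range M,
      (if n ∈ (Finset.range (N+1)).filter Nat.Prime then (1:ℝ)/n else 0)
      ≤ 12 * Real.log (Real.log x) := by
    refine le_trans ?_ (mertens N x hx hNx)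
    rw [← Finset.sum_filter]
    apply Finset.sum_le_sum_of_subset_of_nonneg
    · intro a ha
      exact (Finset.mem_filter.1 ha).2
    · intros; positivity
  have c2 : ∑ n ∈ Finset.range M, (if N < n then ((n:ℝ)^2)⁻¹ else 0) ≤ 2 / (N+1) := by
    refine le_trans ?_ (sum_Ioo_inv_sq_le (α := ℝ) N M)
    rw [← Finset.sum_filter]
    apply Finset.sum_le_sum_of_subset_of_nonneg
    · intro a ha
      simp only [Finset.mem_filter, Finset.mem_range, Finset.mem_Ioo] at *
      omega
    · intros; positivity
  have d1 := mul_le_mul_of_nonneg_left c1 (by positivity : 0 ≤ 4 * x)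
  have d2 := mul_le_mul_of_nonneg_left c2 (by positivity : 0 ≤ 2 * x^2 / ((N:ℝ)+1))
  have d3 : 2 * x^2 / ((N:ℝ)+1) * (2 / (N+1)) ≤ 4 * x := by
    rw [div_mul_div_comm, div_le_iff₀ (by positivity)]
    nlinarith
  nlinarith

/-- **Gcd sums for `B(n) = A(n) − A*(n)`** (Theorem `Th_B_gcd`), where
`A(n) = Σ_{p^ν ∥ n} ν p` and `A*(n) = Σ_{p ∣ n} p` (here `ν = n.factorization p`).
For fixed `k ≥ 2`:
`Σ_{n₁,…,n_k ≤ x} B(gcd(n₁,…,n_k)) = x^k Σ_p 1/(p^{k−1}(p^k − 1)) + R(x)`,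
the constant series over primes being absolutely convergent, with
`R(x) = O(x^{k−1})` if `k ≥ 3` and `R(x) = O(x log log x)` if `k = 2`. -/
theorem stmt_18 (k : ℕ) (hk : 2 ≤ k) :
    Summable (fun p : Nat.Primes =>
      |1 / (((p : ℕ) : ℝ) ^ (k - 1) * (((p : ℕ) : ℝ) ^ k - 1))|) ∧
    ((3 ≤ k →
      ∃ c > (0 : ℝ), ∃ x₀ : ℝ, 3 ≤ x₀ ∧ ∀ x ≥ x₀,
        |(∑ n ∈ Fintype.piFinset (fun _ : Fin k => Finset.Icc 1 ⌊x⌋₊),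
            ((∑ p ∈ (Finset.univ.gcd n).primeFactors,
                ((Finset.univ.gcd n).factorization p : ℝ) * (p : ℝ)) -
              ∑ p ∈ (Finset.univ.gcd n).primeFactors, (p : ℝ))) -
          x ^ k * ∑' p : Nat.Primes,
            1 / (((p : ℕ) : ℝ) ^ (k - 1) * (((p : ℕ) : ℝ) ^ k - 1))| ≤
          c * x ^ (k - 1)) ∧
     (k = 2 →
      ∃ c > (0 : ℝ), ∃ x₀ : ℝ, 3 ≤ x₀ ∧ ∀ x ≥ x₀,
        |(∑ n ∈ Fintype.piFinset (fun _ : Fin k => Finset.Icc 1 ⌊x⌋₊),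
            ((∑ p ∈ (Finset.univ.gcd n).primeFactors,
                ((Finset.univ.gcd n).factorization p : ℝ) * (p : ℝ)) -
              ∑ p ∈ (Finset.univ.gcd n).primeFactors, (p : ℝ))) -
          x ^ k * ∑' p : Nat.Primes,
            1 / (((p : ℕ) : ℝ) ^ (k - 1) * (((p : ℕ) : ℝ) ^ k - 1))| ≤
          c * x * Real.log (Real.log x))) := by
  refine ⟨?_, ?_, ?_⟩
  · exact (summable_subtype_iff_indicator.2 (summ k hk) :
      Summable (fun p : Nat.Primes => cc k (p : ℕ))).abs
  · intro hk3
    refine ⟨4 * k, by positivity, 3, le_rfl, fun x hx => ?_⟩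
    have hx0 : 0 ≤ x := by linarith
    exact total k hk x hx0 _ (case3 k hk3 x hx0)
  · rintro rfl
    have he : 2 ≤ Real.exp 1 := by linarith [Real.add_one_le_exp (1:ℝ)]
    have he2 : 3 ≤ Real.exp (Real.exp 1) := by linarith [Real.add_one_le_exp (Real.exp 1)]
    refine ⟨52, by norm_num, Real.exp (Real.exp 1), he2, fun x hx => ?_⟩
    exact total 2 hk x (by linarith) _ (case2 x hx)
end

section
/- Let B(n) = A(n) − A*(n), where A(n) = Σ_{p^ν || n} ν·p and A*(n) = Σ_{p | n} p, and let k ≥ 2 be a fixed integer. Then Σ_{n₁,…,n_k ≤ x} B(lcm(n₁,…,n_k)) = k·x^k·log log √x + H_k·x^k + O( x^k / log x ) as x → ∞, where H_k = k·F + Σ_{j=2}^{k} (−1)^{j−1}·binom(k,j)·Σ_p 1/( p^{j−1}·(p^j − 1) ), with F = γ + Σ_p ( log(1 − 1/p) + 1/(p−1) ), all sums over p ranging over all primes (absolutely convergent), binom(k,j) the binomial coefficient, and log log √x = log( (log x)/2 ). -/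
section
lemma aux_log_factorial (N : ℕ) :
    Real.log (N.factorial : ℝ) =
      ∑ p ∈ Nat.primesLE N, ((N.factorial).factorization p : ℝ) * Real.log p := by
  rw [Real.log_nat_eq_sum_factorization, Finsupp.sum]
  apply Finset.sum_subset
  · intro p hp
    rw [Nat.support_factorization, Nat.mem_primeFactors] at hp
    rw [Nat.mem_primesLE]
    exact ⟨(hp.1.dvd_factorial).1 hp.2.1, hp.1⟩
  · intro p _ hp
    rw [Finsupp.notMem_support_iff] at hp
    simp [hp]

lemma aux_val_lower (N p : ℕ) (hp : p.Prime) :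
    (N : ℝ) / p - 1 ≤ ((N.factorial).factorization p : ℝ) := by
  have h1 : N / p ≤ (N.factorial).factorization p := by
    rw [← hp.pow_dvd_iff_le_factorization (Nat.factorial_ne_zero N)]
    have h2 : (p ^ (N / p)) ∣ (p * (N / p)).factorial := by
      haveI := Fact.mk hp
      rw [padicValNat_dvd_iff_le (Nat.factorial_ne_zero _), padicValNat_factorial_mul]
      omega
    exact h2.trans (Nat.factorial_dvd_factorial (Nat.mul_div_le N p))
  have h3 : (N : ℝ) / p < (N / p : ℕ) + 1 := by
    have := Nat.lt_floor_add_one ((N : ℝ) / p)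
    rwa [Nat.floor_div_eq_div] at this
  have h4 : ((N / p : ℕ) : ℝ) ≤ ((N.factorial).factorization p : ℝ) := by exact_mod_cast h1
  linarith

lemma aux_val_upper (N p : ℕ) (hp : p.Prime) :
    ((N.factorial).factorization p : ℝ) ≤ (N : ℝ) / (p - 1) := by
  haveI := Fact.mk hp
  have h := sub_one_mul_padicValNat_factorial (p := p) N
  have h1 : (p - 1) * (N.factorial).factorization p ≤ N := by
    rw [Nat.factorization_def _ hp, h]; omega
  have h2 : (1 : ℝ) < p := by exact_mod_cast hp.one_lt
  rw [le_div_iff₀ (by linarith)]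
  have h3 : (((p - 1 : ℕ) : ℝ)) * ((N.factorial).factorization p : ℝ) ≤ N := by exact_mod_cast h1
  rw [Nat.cast_sub hp.one_lt.le] at h3
  push_cast at h3
  linarith

lemma aux_sum_log_bdd : ∃ C : ℝ, ∀ N : ℕ,
    ∑ p ∈ Nat.primesLE N, Real.log p / ((p : ℝ) * (p - 1)) ≤ C := by
  have hs : Summable (fun n : ℕ => 4 * (1 / (n : ℝ) ^ (3 / 2 : ℝ))) :=
    (Real.summable_one_div_nat_rpow.2 (by norm_num)).mul_left 4
  refine ⟨∑' n : ℕ, 4 * (1 / (n : ℝ) ^ (3 / 2 : ℝ)), fun N => ?_⟩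
  refine le_trans (Finset.sum_le_sum (g := fun n : ℕ => 4 * (1 / (n : ℝ) ^ (3 / 2 : ℝ))) ?_)
    (hs.sum_le_tsum _ (fun i _ => by positivity))
  intro p hp
  have hp2 : (2 : ℝ) ≤ p := by exact_mod_cast Nat.two_le_of_mem_primesLE hp
  have hl : Real.log p ≤ (p : ℝ) ^ (1 / 2 : ℝ) / (1 / 2) :=
    Real.log_le_rpow_div (by linarith) (by norm_num)
  have hpp : (p : ℝ) ^ (3 / 2 : ℝ) * (p : ℝ) ^ (1 / 2 : ℝ) = (p : ℝ) ^ 2 := by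
    rw [← Real.rpow_add (by linarith), ← Real.rpow_natCast]; norm_num
  have hpos : 0 < (p : ℝ) ^ (3 / 2 : ℝ) := by positivity
  rw [mul_one_div, div_le_div_iff₀ (by nlinarith) hpos]
  calc Real.log p * (p : ℝ) ^ (3 / 2 : ℝ) ≤ ((p : ℝ) ^ (1 / 2 : ℝ) / (1 / 2)) * (p : ℝ) ^ (3 / 2 : ℝ) := by gcongr
    _ = 2 * (p : ℝ) ^ 2 := by rw [← hpp]; ring
    _ ≤ 4 * (p * (p - 1)) := by nlinarith

lemma aux_mertens1 : ∃ C : ℝ, 0 ≤ C ∧ ∀ N : ℕ, 1 ≤ N →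
    |(∑ p ∈ Nat.primesLE N, Real.log p / p) - Real.log N| ≤ C := by
  obtain ⟨C, hC⟩ := aux_sum_log_bdd
  refine ⟨max (Real.log 4) (1 + C), le_trans (Real.log_nonneg (by norm_num)) (le_max_left _ _), fun N hN => ?_⟩
  have hN0 : (0 : ℝ) < N := by exact_mod_cast hN
  have hf := aux_log_factorial N
  have hup : Real.log (N.factorial : ℝ) ≤ N * Real.log N := by
    rw [← Real.log_pow]
    apply Real.log_le_log (by positivity)
    exact_mod_cast Nat.factorial_le_pow N
  have hlo : N * Real.log N - N ≤ Real.log (N.factorial : ℝ) := by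
    have := Stirling.le_log_factorial_stirling (n := N) (by omega)
    have h1 : 0 ≤ Real.log N := Real.log_natCast_nonneg N
    have h2 : 0 ≤ Real.log (2 * Real.pi) := Real.log_nonneg (by linarith [Real.pi_gt_three])
    linarith
  have hth : ∑ p ∈ Nat.primesLE N, Real.log (p : ℝ) ≤ Real.log 4 * N := by
    rw [← Chebyshev.theta_eq_sum_primesLE_log]
    exact Chebyshev.theta_le_log4_mul_x hN0.le
  have hA : N * (∑ p ∈ Nat.primesLE N, Real.log p / p) - ∑ p ∈ Nat.primesLE N, Real.log (p : ℝ)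
      ≤ Real.log (N.factorial : ℝ) := by
    rw [hf, Finset.mul_sum, ← Finset.sum_sub_distrib]
    apply Finset.sum_le_sum
    intro p hp
    have h := aux_val_lower N p (Nat.prime_of_mem_primesLE hp)
    have h1 : 0 ≤ Real.log p := Real.log_natCast_nonneg p
    calc _ = ((N : ℝ) / p - 1) * Real.log p := by ring
      _ ≤ _ := by gcongr
  have hB : Real.log (N.factorial : ℝ) ≤ N * (∑ p ∈ Nat.primesLE N, Real.log p / p)
      + N * ∑ p ∈ Nat.primesLE N, Real.log p / ((p : ℝ) * (p - 1)) := by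
    rw [hf, Finset.mul_sum, Finset.mul_sum, ← Finset.sum_add_distrib]
    apply Finset.sum_le_sum
    intro p hp
    have h := aux_val_upper N p (Nat.prime_of_mem_primesLE hp)
    have hp2 : (2 : ℝ) ≤ p := by exact_mod_cast Nat.two_le_of_mem_primesLE hp
    have h1 : 0 ≤ Real.log p := Real.log_natCast_nonneg p
    have h3 : (p : ℝ) - 1 ≠ 0 := by linarith
    calc _ ≤ ((N : ℝ) / (p - 1)) * Real.log p := by gcongr
      _ = _ := by field_simp; ring
  have hC' := hC N
  rw [abs_le]
  constructor
  · have : N * Real.log N - N ≤ N * (∑ p ∈ Nat.primesLE N, Real.log p / p) + N * C := by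
      have := mul_le_mul_of_nonneg_left hC' hN0.le
      linarith
    have : Real.log N - 1 ≤ (∑ p ∈ Nat.primesLE N, Real.log p / p) + C := by
      apply le_of_mul_le_mul_left _ hN0
      linarith
    have := le_max_right (Real.log 4) (1 + C)
    linarith
  · have : (∑ p ∈ Nat.primesLE N, Real.log p / p) ≤ Real.log N + Real.log 4 := by
      apply le_of_mul_le_mul_left _ hN0
      linarith
    have := le_max_left (Real.log 4) (1 + C)
    linarith

end

section
lemma aux_U_step (C : ℝ)
    (hC : ∀ N : ℕ, 1 ≤ N → |(∑ p ∈ Nat.primesLE N, Real.log p / p) - Real.log N| ≤ C)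
    (U : ℕ → ℝ) (hU : ∀ n, U n = (∑ p ∈ Nat.primesLE n, 1 / (p : ℝ))
      - (∑ p ∈ Nat.primesLE n, Real.log p / p) / Real.log n + 1 - Real.log (Real.log n))
    (n : ℕ) (hn : 2 ≤ n) :
    |U (n + 1) - U n| ≤ (C + 1) * (1 / Real.log n - 1 / Real.log ((n + 1 : ℕ) : ℝ)) := by
  have hn2 : (2 : ℝ) ≤ n := by exact_mod_cast hn
  have hE := hC n (by omega)
  set S := ∑ p ∈ Nat.primesLE n, Real.log p / p with hS
  set R := ∑ p ∈ Nat.primesLE n, 1 / (p : ℝ) with hR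
  set a := Real.log n with ha
  set b := Real.log ((n + 1 : ℕ) : ℝ) with hb
  have ha0 : 0 < a := Real.log_pos (by linarith)
  have hab : a < b := by
    apply Real.log_lt_log (by linarith)
    push_cast; linarith
  have hb0 : 0 < b := ha0.trans hab
  have hba1 : b - a ≤ 1 := by
    rw [hb, ha, ← Real.log_div (by positivity) (by positivity)]
    have h1 : ((n + 1 : ℕ) : ℝ) / n = 1 + 1 / n := by push_cast; field_simp
    have := Real.log_le_sub_one_of_pos (x := ((n + 1 : ℕ) : ℝ) / n) (by positivity)
    have h2 : (1 : ℝ) / n ≤ 1 := by rw [div_le_one (by linarith)]; linarith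
    linarith
  have hkey : (∑ p ∈ Nat.primesLE (n + 1), 1 / (p : ℝ))
      - (∑ p ∈ Nat.primesLE (n + 1), Real.log p / p) / b = R - S / b := by
    rw [Nat.primesLE_succ]
    split_ifs with h
    · rw [Finset.sum_insert (Nat.notMem_primesLE n), Finset.sum_insert (Nat.notMem_primesLE n),
        ← hb, ← hR, ← hS]
      field_simp; ring
    · rfl
  have e1 : U (n + 1) - U n = (S - a) * (1 / a - 1 / b) + ((b - a) / b - (Real.log b - Real.log a)) := by
    rw [hU (n + 1), hU n, ← ha, ← hb, hkey, ← hS, ← hR]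
    field_simp; ring
  have hd : 0 < 1 / a - 1 / b := by
    rw [sub_pos]; exact one_div_lt_one_div_of_lt ha0 hab
  have hl1 : Real.log b - Real.log a ≤ (b - a) / a := by
    rw [← Real.log_div hb0.ne' ha0.ne']
    have := Real.log_le_sub_one_of_pos (x := b / a) (by positivity)
    have h3 : b / a - 1 = (b - a) / a := by field_simp
    linarith
  have hl2 : (b - a) / b ≤ Real.log b - Real.log a := by
    have := Real.log_le_sub_one_of_pos (x := a / b) (by positivity)
    rw [Real.log_div ha0.ne' hb0.ne'] at this
    have h3 : a / b - 1 = - ((b - a) / b) := by field_simp; ring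
    linarith
  have h5 : (b - a) / a - (b - a) / b ≤ 1 / a - 1 / b := by
    have : (b - a) / a - (b - a) / b = (b - a) * (1 / a - 1 / b) := by ring
    rw [this]
    nlinarith
  rw [e1]
  calc _ ≤ |(S - a) * (1 / a - 1 / b)| + |((b - a) / b - (Real.log b - Real.log a))| := abs_add_le _ _
    _ ≤ C * (1 / a - 1 / b) + (1 / a - 1 / b) := by
      apply add_le_add
      · rw [abs_mul, abs_of_pos hd]; gcongr
      · rw [abs_le]; constructor <;> linarith
    _ = _ := by ring

lemma aux_limit (U L : ℕ → ℝ) (hL : ∀ n, 0 ≤ L n)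
    (hL0 : Filter.Tendsto L Filter.atTop (nhds 0))
    (h : ∀ n, |U (n + 1) - U n| ≤ L n - L (n + 1)) :
    ∃ M, ∀ n, |U n - M| ≤ L n := by
  have hanti : Antitone (fun n => U n + L n) := by
    apply antitone_nat_of_succ_le
    intro n
    have := abs_le.1 (h n)
    linarith [this.2]
  have hmono : Monotone (fun n => U n - L n) := by
    apply monotone_nat_of_le_succ
    intro n
    have := abs_le.1 (h n)
    linarith [this.1]
  have hbdd : BddBelow (Set.range (fun n => U n + L n)) := by
    refine ⟨U 0 - L 0, ?_⟩
    rintro _ ⟨n, rfl⟩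
    have := hmono (Nat.zero_le n)
    simp only at this ⊢
    linarith [hL n]
  have ht := tendsto_atTop_ciInf hanti hbdd
  set M := ⨅ n, (U n + L n)
  have ht2 : Filter.Tendsto (fun n => U n - L n) Filter.atTop (nhds M) := by
    have := (ht.sub hL0).sub hL0
    simp only [sub_zero] at this
    refine this.congr (fun n => by ring)
  refine ⟨M, fun n => ?_⟩
  have h1 := hanti.le_of_tendsto ht n
  have h2 := hmono.ge_of_tendsto ht2 n
  rw [abs_le]; constructor <;> linarith

lemma aux_mertens2_nat : ∃ M C : ℝ, 0 ≤ C ∧ ∀ n : ℕ, 2 ≤ n →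
    |(∑ p ∈ Nat.primesLE n, 1 / (p : ℝ)) - Real.log (Real.log n) - M| ≤ C / Real.log n := by
  obtain ⟨C, hC0, hC⟩ := aux_mertens1
  set U : ℕ → ℝ := fun n => (∑ p ∈ Nat.primesLE n, 1 / (p : ℝ))
      - (∑ p ∈ Nat.primesLE n, Real.log p / p) / Real.log n + 1 - Real.log (Real.log n) with hU
  have hstep := aux_U_step C hC U (fun n => rfl)
  obtain ⟨M, hM⟩ := aux_limit (fun n => U (n + 2)) (fun n => (C + 1) * (1 / Real.log ((n + 2 : ℕ) : ℝ)))
    (fun n => by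
      have := Real.log_natCast_nonneg (n + 2)
      positivity)
    (by
      have h1 : Filter.Tendsto (fun n : ℕ => Real.log ((n + 2 : ℕ) : ℝ)) Filter.atTop Filter.atTop :=
        Real.tendsto_log_atTop.comp (tendsto_natCast_atTop_atTop.comp (Filter.tendsto_add_atTop_nat 2))
      have := (h1.inv_tendsto_atTop).const_mul (C + 1)
      simpa using this)
    (fun n => by
      have := hstep (n + 2) (by omega)
      rw [mul_sub] at this
      exact this)
  refine ⟨M, 2 * C + 1, by positivity, fun n hn => ?_⟩
  obtain ⟨m, rfl⟩ : ∃ m, n = m + 2 := ⟨n - 2, by omega⟩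
  have h1 := hM m
  have h2 := hC (m + 2) (by omega)
  have hpos : 0 < Real.log ((m + 2 : ℕ) : ℝ) := Real.log_pos (by push_cast; linarith [(Nat.cast_nonneg m : (0:ℝ) ≤ m)])
  simp only [hU] at h1
  set l := Real.log ((m + 2 : ℕ) : ℝ)
  set S := ∑ p ∈ Nat.primesLE (m + 2), Real.log (p:ℝ) / p
  set R := ∑ p ∈ Nat.primesLE (m + 2), 1 / (p : ℝ)
  have e : R - Real.log l - M = (R - S / l + 1 - Real.log l - M) + (S - l) / l := by
    field_simp; ring
  rw [e]
  calc _ ≤ |R - S / l + 1 - Real.log l - M| + |(S - l) / l| := abs_add_le _ _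
    _ ≤ (C + 1) * (1 / l) + C / l := by
      apply add_le_add h1
      rw [abs_div, abs_of_pos hpos]; gcongr
    _ = _ := by ring

lemma aux_mertens2 : ∃ M C : ℝ, 0 ≤ C ∧ ∀ y : ℝ, 2 ≤ y →
    |(∑ p ∈ Nat.primesLE ⌊y⌋₊, 1 / (p : ℝ)) - Real.log (Real.log y) - M| ≤ C / Real.log y := by
  obtain ⟨M, C, hC0, hC⟩ := aux_mertens2_nat
  refine ⟨M, 2 * C + 2, by positivity, fun y hy => ?_⟩
  have hn : 2 ≤ ⌊y⌋₊ := Nat.le_floor (by exact_mod_cast hy)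
  have h := hC _ hn
  have hn2 : (2 : ℝ) ≤ (⌊y⌋₊ : ℝ) := by exact_mod_cast hn
  have hle : (⌊y⌋₊ : ℝ) ≤ y := Nat.floor_le (by linarith)
  have hlt : y < (⌊y⌋₊ : ℝ) + 1 := Nat.lt_floor_add_one y
  set R := ∑ p ∈ Nat.primesLE ⌊y⌋₊, 1 / (p : ℝ)
  set n := (⌊y⌋₊ : ℝ)
  have ha0 : 0 < Real.log n := Real.log_pos (by linarith)
  have hab : Real.log n ≤ Real.log y := Real.log_le_log (by linarith) hle
  have hb0 : 0 < Real.log y := ha0.trans_le hab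
  have h2 : Real.log y ≤ 2 * Real.log n := by
    rw [show 2 * Real.log n = Real.log (n ^ 2) by rw [Real.log_pow]; norm_num]
    apply Real.log_le_log (by linarith); nlinarith
  have h3 : Real.log y - Real.log n ≤ 1 := by
    rw [← Real.log_div (by linarith) (by linarith)]
    have := Real.log_le_sub_one_of_pos (x := y / n) (div_pos (by linarith) (by linarith))
    have h4 : y / n ≤ 2 := by rw [div_le_iff₀ (by linarith)]; linarith
    linarith
  have h4 : |Real.log (Real.log n) - Real.log (Real.log y)| ≤ 2 / Real.log y := by
    rw [abs_sub_comm, abs_of_nonneg (sub_nonneg.2 (Real.log_le_log ha0 hab)),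
      ← Real.log_div hb0.ne' ha0.ne']
    refine (Real.log_le_sub_one_of_pos (div_pos hb0 ha0)).trans ?_
    rw [show Real.log y / Real.log n - 1 = (Real.log y - Real.log n) / Real.log n by field_simp,
      div_le_div_iff₀ ha0 hb0]
    nlinarith
  have h5 : C / Real.log n ≤ 2 * C / Real.log y := by
    rw [div_le_div_iff₀ ha0 hb0]; nlinarith
  have e : R - Real.log (Real.log y) - M = (R - Real.log (Real.log n) - M) +
    (Real.log (Real.log n) - Real.log (Real.log y)) := by ring
  rw [e]
  calc _ ≤ |R - Real.log (Real.log n) - M| + |Real.log (Real.log n) - Real.log (Real.log y)| := abs_add_le _ _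
    _ ≤ 2 * C / Real.log y + 2 / Real.log y := add_le_add (h.trans h5) h4
    _ = _ := by ring

end

section
open Filter Topology

lemma aux_log_abs {t : ℝ} (h0 : 0 ≤ t) (h1 : t ≤ 1 / 2) : |Real.log (1 - t) + t| ≤ 2 * t ^ 2 := by
  have h := Real.abs_log_sub_add_sum_range_le (x := t) (by rw [abs_of_nonneg h0]; linarith) 1
  simp only [Finset.sum_range_one, abs_of_nonneg h0] at h
  norm_num at h
  rw [add_comm]
  refine h.trans ?_
  rw [div_le_iff₀ (by linarith)]
  nlinarith [sq_nonneg t]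

lemma aux_prime_rpow_le {s : ℝ} (hs : 1 ≤ s) (p : Nat.Primes) :
    ((p : ℕ) : ℝ) ^ (-s) ≤ 1 / ((p : ℕ) : ℝ) := by
  have hp : (2 : ℝ) ≤ ((p : ℕ) : ℝ) := by exact_mod_cast p.2.two_le
  rw [one_div, ← Real.rpow_neg_one]
  exact Real.rpow_le_rpow_of_exponent_le (by linarith) (by linarith)

lemma aux_prime_half (p : Nat.Primes) : 1 / ((p : ℕ) : ℝ) ≤ 1 / 2 := by
  have hp : (2 : ℝ) ≤ ((p : ℕ) : ℝ) := by exact_mod_cast p.2.two_le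
  exact one_div_le_one_div_of_le (by norm_num) hp

lemma aux_summable_sq : Summable (fun p : Nat.Primes => 2 * (1 / ((p : ℕ) : ℝ)) ^ 2) := by
  have h : Summable (fun n : ℕ => 1 / (n : ℝ) ^ 2) := Real.summable_one_div_nat_pow.2 (by norm_num)
  have := (h.comp_injective (Subtype.val_injective : Function.Injective (fun p : Nat.Primes => (p : ℕ)))).mul_left 2
  refine this.congr (fun p => ?_)
  simp

lemma aux_W_bound {s : ℝ} (hs : 1 ≤ s) (p : Nat.Primes) :
    |Real.log (1 - ((p : ℕ) : ℝ) ^ (-s)) + ((p : ℕ) : ℝ) ^ (-s)| ≤ 2 * (1 / ((p : ℕ) : ℝ)) ^ 2 := by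
  have h0 : 0 ≤ ((p : ℕ) : ℝ) ^ (-s) := by positivity
  have h1 := aux_prime_rpow_le hs p
  refine (aux_log_abs h0 (h1.trans (aux_prime_half p))).trans ?_
  gcongr

lemma aux_W_summable {s : ℝ} (hs : 1 ≤ s) :
    Summable (fun p : Nat.Primes => Real.log (1 - ((p : ℕ) : ℝ) ^ (-s)) + ((p : ℕ) : ℝ) ^ (-s)) :=
  Summable.of_norm_bounded aux_summable_sq (fun p => aux_W_bound hs p)

lemma aux_W_tendsto :
    Tendsto (fun δ : ℝ => ∑' p : Nat.Primes,
      (Real.log (1 - ((p : ℕ) : ℝ) ^ (-(1 + δ))) + ((p : ℕ) : ℝ) ^ (-(1 + δ)))) (𝓝[>] 0)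
      (𝓝 (∑' p : Nat.Primes, (Real.log (1 - 1 / ((p : ℕ) : ℝ)) + 1 / ((p : ℕ) : ℝ)))) := by
  apply tendsto_tsum_of_dominated_convergence aux_summable_sq
  · intro p
    have hp : (2 : ℝ) ≤ ((p : ℕ) : ℝ) := by exact_mod_cast p.2.two_le
    have hc : Tendsto (fun δ : ℝ => ((p : ℕ) : ℝ) ^ (-(1 + δ))) (𝓝[>] 0) (𝓝 (1 / ((p : ℕ) : ℝ))) := by
      have : ContinuousAt (fun δ : ℝ => ((p : ℕ) : ℝ) ^ (-(1 + δ))) 0 := by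
        apply ContinuousAt.rpow continuousAt_const (by fun_prop)
        left; simp only [ne_eq]; linarith
      have h2 := this.tendsto
      rw [show ((p : ℕ) : ℝ) ^ (-(1 + (0:ℝ))) = 1 / ((p : ℕ) : ℝ) by
        rw [add_zero, Real.rpow_neg_one, one_div]] at h2
      exact h2.mono_left nhdsWithin_le_nhds
    refine Tendsto.add (Tendsto.log (tendsto_const_nhds.sub hc) ?_) hc
    have := aux_prime_half p
    linarith
  · filter_upwards [self_mem_nhdsWithin] with δ hδ p
    exact aux_W_bound (by linarith [Set.mem_Ioi.1 hδ]) p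

lemma aux_euler {s : ℝ} (hs : 1 < s) :
    HasSum (fun p : Nat.Primes => - Real.log (1 - ((p : ℕ) : ℝ) ^ (-s)))
      (Real.log (∑' n : ℕ, 1 / (n : ℝ) ^ s)) := by
  let f : ℕ →*₀ ℝ :=
    { toFun := fun n => (n : ℝ) ^ (-s)
      map_zero' := by
        rw [Nat.cast_zero, Real.zero_rpow (by linarith)]
      map_one' := by simp
      map_mul' := fun a b => by
        rw [Nat.cast_mul, Real.mul_rpow (Nat.cast_nonneg a) (Nat.cast_nonneg b)] }
  have hf : ∀ n : ℕ, f n = 1 / (n : ℝ) ^ s := fun n => by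
    change (n : ℝ) ^ (-s) = _
    rw [Real.rpow_neg (Nat.cast_nonneg n), one_div]
  have hsum : Summable (fun n : ℕ => 1 / (n : ℝ) ^ s) := Real.summable_one_div_nat_rpow.2 hs
  have hsum' : Summable (fun n => ‖f n‖) := by
    refine hsum.congr (fun n => ?_)
    rw [hf, Real.norm_of_nonneg (by positivity)]
  have hprod := EulerProduct.eulerProduct_completely_multiplicative_hasProd hsum'
  simp_rw [hf] at hprod
  have hpos : 0 < ∑' n : ℕ, 1 / (n : ℝ) ^ s := by
    apply hsum.tsum_pos (fun n => by positivity) 1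
    simp
  have h := Tendsto.log hprod hpos.ne'
  refine h.congr (fun F => ?_)
  rw [Real.log_prod]
  · apply Finset.sum_congr rfl
    intro p _
    change Real.log (1 - 1 / ((p : ℕ) : ℝ) ^ s)⁻¹ = - Real.log (1 - ((p : ℕ) : ℝ) ^ (-s))
    rw [Real.log_inv, Real.rpow_neg (Nat.cast_nonneg _), one_div]
  · intro p _
    have h1 := aux_prime_rpow_le hs.le p
    have h2 := aux_prime_half p
    rw [Real.rpow_neg (Nat.cast_nonneg _), ← one_div] at h1
    apply inv_ne_zero
    linarith

lemma aux_P_summable {δ : ℝ} (hδ : 0 < δ) :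
    Summable (fun p : Nat.Primes => ((p : ℕ) : ℝ) ^ (-(1 + δ))) :=
  Nat.Primes.summable_rpow.2 (by linarith)

lemma aux_P_eq {δ : ℝ} (hδ : 0 < δ) :
    ∑' p : Nat.Primes, ((p : ℕ) : ℝ) ^ (-(1 + δ)) = Real.log (∑' n : ℕ, 1 / (n : ℝ) ^ (1 + δ)) +
      ∑' p : Nat.Primes,
      (Real.log (1 - ((p : ℕ) : ℝ) ^ (-(1 + δ))) + ((p : ℕ) : ℝ) ^ (-(1 + δ))) := by
  have h1 := aux_euler (s := 1 + δ) (by linarith)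
  have h2 := (aux_W_summable (s := 1 + δ) (by linarith)).hasSum
  rw [← (h1.add h2).tsum_eq]
  apply tsum_congr
  intro p; ring

lemma aux_zeta_log : Tendsto (fun δ : ℝ => Real.log (∑' n : ℕ, 1 / (n : ℝ) ^ (1 + δ)) + Real.log δ)
    (𝓝[>] 0) (𝓝 0) := by
  have h := tendsto_sub_mul_tsum_nat_rpow
  have ht : Tendsto (fun δ : ℝ => 1 + δ) (𝓝[>] 0) (𝓝[>] 1) := by
    apply tendsto_nhdsWithin_of_tendsto_nhds_of_eventually_within
    · have : Tendsto (fun δ : ℝ => 1 + δ) (𝓝 0) (𝓝 (1 + 0)) := by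
        apply Continuous.tendsto; fun_prop
      rw [add_zero] at this
      exact this.mono_left nhdsWithin_le_nhds
    · filter_upwards [self_mem_nhdsWithin] with δ hδ
      simpa using hδ
  have h2 := Tendsto.log (h.comp ht) one_ne_zero
  rw [Real.log_one] at h2
  refine h2.congr' ?_
  filter_upwards [self_mem_nhdsWithin] with δ hδ
  have hδ : 0 < δ := hδ
  have hpos : 0 < ∑' n : ℕ, 1 / (n : ℝ) ^ (1 + δ) := by
    apply (Real.summable_one_div_nat_rpow.2 (by linarith)).tsum_pos (fun n => by positivity) 1
    simp
  simp only [Function.comp, add_sub_cancel_left]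
  rw [Real.log_mul hδ.ne' hpos.ne', add_comm]

lemma aux_exp_log : Tendsto (fun δ : ℝ => Real.log (1 - Real.exp (-δ)) - Real.log δ)
    (𝓝[>] 0) (𝓝 0) := by
  have hd : HasDerivAt (fun t : ℝ => - Real.exp (-t)) 1 0 := by
    have h1 : HasDerivAt (fun t : ℝ => -t) (-1) 0 := hasDerivAt_neg 0
    have h2 : HasDerivAt (fun t : ℝ => Real.exp (-t)) (-1) 0 := by simpa using h1.exp
    have h3 : HasDerivAt (fun t : ℝ => - Real.exp (-t)) (- -1) 0 := h2.neg
    rwa [neg_neg] at h3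
  have h := (hasDerivAt_iff_tendsto_slope_zero.1 hd).mono_left (nhdsGT_le_nhdsNE 0)
  have h2 := Tendsto.log h one_ne_zero
  rw [Real.log_one] at h2
  refine h2.congr' ?_
  filter_upwards [self_mem_nhdsWithin] with δ hδ
  have hδ : 0 < δ := hδ
  have : Real.exp (-δ) < 1 := by simpa using hδ
  rw [← Real.log_div (by linarith) hδ.ne']
  congr 1
  simp
  field_simp
  ring

/-- Abel coefficient. -/
noncomputable def auxA (c : ℕ) : ℝ :=
  ∑ n ∈ Nat.primesLE ⌊Real.exp c⌋₊, if ⌈Real.log n⌉₊ = c then 1 / (n : ℝ) else 0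

lemma aux_A_partial (N : ℕ) :
    ∑ c ∈ Finset.range (N + 1), auxA c = ∑ p ∈ Nat.primesLE ⌊Real.exp N⌋₊, 1 / (p : ℝ) := by
  have hmem : ∀ (c n : ℕ), n.Prime → (⌈Real.log n⌉₊ ≤ c ↔ n ∈ Nat.primesLE ⌊Real.exp c⌋₊) := by
    intro c n hn
    rw [Nat.mem_primesLE, Nat.le_floor_iff (Real.exp_pos _).le, Nat.ceil_le,
      Real.log_le_iff_le_exp (by exact_mod_cast hn.pos)]
    simp [hn]
  have h1 : ∀ c ∈ Finset.range (N + 1), auxA c =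
      ∑ n ∈ Nat.primesLE ⌊Real.exp N⌋₊, if ⌈Real.log n⌉₊ = c then 1 / (n : ℝ) else 0 := by
    intro c hc
    rw [Finset.mem_range] at hc
    apply Finset.sum_subset
    · intro n hn
      have hp := Nat.prime_of_mem_primesLE hn
      rw [← hmem N n hp]
      rw [← hmem c n hp] at hn
      omega
    · intro n hn hn'
      have hp := Nat.prime_of_mem_primesLE hn
      rw [← hmem c n hp] at hn'
      rw [if_neg (by omega)]
  rw [Finset.sum_congr rfl h1, Finset.sum_comm]
  apply Finset.sum_congr rfl
  intro n hn
  have hp := Nat.prime_of_mem_primesLE hn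
  rw [← hmem N n hp] at hn
  rw [Finset.sum_ite_eq, if_pos (by rw [Finset.mem_range]; omega)]

lemma aux_fiber (x : ℝ) (c : ℕ) :
    (∑' b : (fun n : ℕ => ⌈Real.log n⌉₊) ⁻¹' {c},
      (Set.indicator {n : ℕ | n.Prime} (fun n : ℕ => 1 / (n : ℝ) * x ^ ⌈Real.log n⌉₊)) b) =
      auxA c * x ^ c := by
  rw [tsum_subtype ((fun n : ℕ => ⌈Real.log n⌉₊) ⁻¹' {c})
    (Set.indicator {n : ℕ | n.Prime} (fun n : ℕ => 1 / (n : ℝ) * x ^ ⌈Real.log n⌉₊))]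
  rw [tsum_eq_sum (s := Nat.primesLE ⌊Real.exp c⌋₊), auxA, Finset.sum_mul]
  · apply Finset.sum_congr rfl
    intro n hn
    have hp := Nat.prime_of_mem_primesLE hn
    by_cases h : ⌈Real.log n⌉₊ = c
    · simp [Set.indicator, hp, h]
    · simp [Set.indicator, h]
  · intro n hn
    by_cases hp : n.Prime
    · rw [Set.indicator_of_notMem]
      simp only [Set.mem_preimage, Set.mem_singleton_iff]
      intro h
      apply hn
      rw [Nat.mem_primesLE, Nat.le_floor_iff (Real.exp_pos _).le,
        ← Real.log_le_iff_le_exp (by exact_mod_cast hp.pos), ← Nat.ceil_le]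
      exact ⟨h.le, hp⟩
    · simp [Set.indicator, hp]

lemma aux_term {δ : ℝ} (hδ : 0 < δ) (p : Nat.Primes) :
    1 / ((p : ℕ) : ℝ) * (Real.exp (-δ)) ^ ⌈Real.log ((p : ℕ) : ℝ)⌉₊ ≤ ((p : ℕ) : ℝ) ^ (-(1 + δ)) ∧
    ((p : ℕ) : ℝ) ^ (-(1 + δ)) - 1 / ((p : ℕ) : ℝ) * (Real.exp (-δ)) ^ ⌈Real.log ((p : ℕ) : ℝ)⌉₊
      ≤ δ * ((p : ℕ) : ℝ) ^ (-(1 + δ)) := by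
  have hp : (2 : ℝ) ≤ ((p : ℕ) : ℝ) := by exact_mod_cast p.2.two_le
  set q := ((p : ℕ) : ℝ)
  have hl : 0 ≤ Real.log q := Real.log_nonneg (by linarith)
  have h1 := Nat.le_ceil (Real.log q)
  have h2 := Nat.ceil_lt_add_one hl
  set m := ⌈Real.log q⌉₊
  have e1 : 1 / q * (Real.exp (-δ)) ^ m = Real.exp (- Real.log q - δ * m) := by
    rw [← Real.exp_nat_mul, sub_eq_add_neg, Real.exp_add, Real.exp_neg, Real.exp_log (by linarith), one_div]
    congr 2; ring
  have e2 : q ^ (-(1 + δ)) = Real.exp (- Real.log q - δ * Real.log q) := by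
    rw [Real.rpow_def_of_pos (by linarith)]; congr 1; ring
  rw [e1, e2]
  constructor
  · apply Real.exp_le_exp.2
    nlinarith
  · have e3 : Real.exp (- Real.log q - δ * m) = Real.exp (- Real.log q - δ * Real.log q) *
      Real.exp (- (δ * (m - Real.log q))) := by
      rw [← Real.exp_add]; congr 1; ring
    rw [e3]
    have h4 := Real.add_one_le_exp (- (δ * (m - Real.log q)))
    have h5 : 0 < Real.exp (- Real.log q - δ * Real.log q) := Real.exp_pos _
    have h6 : δ * (m - Real.log q) ≤ δ := by nlinarith
    nlinarith

lemma aux_Pt_summable {δ : ℝ} (hδ : 0 < δ) :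
    Summable (fun p : Nat.Primes =>
      1 / ((p : ℕ) : ℝ) * (Real.exp (-δ)) ^ ⌈Real.log ((p : ℕ) : ℝ)⌉₊) :=
  Summable.of_nonneg_of_le (fun p => by positivity) (fun p => (aux_term hδ p).1) (aux_P_summable hδ)

lemma aux_Pt_hasSum {δ : ℝ} (hδ : 0 < δ) :
    HasSum (fun c => auxA c * (Real.exp (-δ)) ^ c) (∑' p : Nat.Primes,
      1 / ((p : ℕ) : ℝ) * (Real.exp (-δ)) ^ ⌈Real.log ((p : ℕ) : ℝ)⌉₊) := by
  have h := (aux_Pt_summable hδ).hasSum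
  have h' : HasSum (Set.indicator {n : ℕ | n.Prime}
      (fun n : ℕ => 1 / (n : ℝ) * (Real.exp (-δ)) ^ ⌈Real.log n⌉₊)) (∑' p : Nat.Primes,
      1 / ((p : ℕ) : ℝ) * (Real.exp (-δ)) ^ ⌈Real.log ((p : ℕ) : ℝ)⌉₊) := by
    rw [← hasSum_subtype_iff_indicator]
    exact h
  have h2 := h'.tsum_fiberwise (fun n : ℕ => ⌈Real.log n⌉₊)
  simp_rw [aux_fiber] at h2
  exact h2

end

section
open Filter Topology

lemma aux_partial_tendsto (M C : ℝ) (h : ∀ y : ℝ, 2 ≤ y →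
    |(∑ p ∈ Nat.primesLE ⌊y⌋₊, 1 / (p : ℝ)) - Real.log (Real.log y) - M| ≤ C / Real.log y) :
    Tendsto (fun n : ℕ => ∑ c ∈ Finset.range n, (auxA c - 1 / (c : ℝ))) atTop
      (𝓝 (M - Real.eulerMascheroniConstant)) := by
  rw [← tendsto_add_atTop_iff_nat 1]
  have h1 : Tendsto (fun n : ℕ => (∑ p ∈ Nat.primesLE ⌊Real.exp n⌋₊, 1 / (p : ℝ)) - Real.log n)
      atTop (𝓝 M) := by
    rw [tendsto_iff_norm_sub_tendsto_zero]
    have hC : Tendsto (fun n : ℕ => C / (n : ℝ)) atTop (𝓝 0) :=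
      tendsto_const_div_atTop_nhds_zero_nat C
    refine squeeze_zero' (Eventually.of_forall fun n => norm_nonneg _) ?_ hC
    filter_upwards [eventually_ge_atTop 1] with n hn
    have h2 : (2 : ℝ) ≤ Real.exp n := by
      have := Real.add_one_le_exp (n : ℝ)
      have : (1 : ℝ) ≤ n := by exact_mod_cast hn
      linarith
    have := h _ h2
    rwa [Real.log_exp] at this
  have h2 := h1.sub Real.tendsto_harmonic_sub_log
  refine h2.congr (fun n => ?_)
  rw [Finset.sum_sub_distrib, aux_A_partial]
  have : ((harmonic n : ℚ) : ℝ) = ∑ c ∈ Finset.range (n + 1), 1 / (c : ℝ) := by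
    rw [Finset.sum_range_succ', harmonic]
    push_cast
    simp
  rw [this]
  ring

lemma aux_Pt_tendsto (M C : ℝ) (h : ∀ y : ℝ, 2 ≤ y →
    |(∑ p ∈ Nat.primesLE ⌊y⌋₊, 1 / (p : ℝ)) - Real.log (Real.log y) - M| ≤ C / Real.log y) :
    Tendsto (fun δ : ℝ => (∑' p : Nat.Primes,
      1 / ((p : ℕ) : ℝ) * (Real.exp (-δ)) ^ ⌈Real.log ((p : ℕ) : ℝ)⌉₊) +
      Real.log (1 - Real.exp (-δ))) (𝓝[>] 0) (𝓝 (M - Real.eulerMascheroniConstant)) := by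
  have h1 := Real.tendsto_tsum_powerSeries_nhdsWithin_lt (aux_partial_tendsto M C h)
  have ht : Tendsto (fun δ : ℝ => Real.exp (-δ)) (𝓝[>] 0) (𝓝[<] 1) := by
    apply tendsto_nhdsWithin_of_tendsto_nhds_of_eventually_within
    · have : Tendsto (fun δ : ℝ => Real.exp (-δ)) (𝓝 0) (𝓝 (Real.exp (-0))) := by
        apply Continuous.tendsto; fun_prop
      rw [neg_zero, Real.exp_zero] at this
      exact this.mono_left nhdsWithin_le_nhds
    · filter_upwards [self_mem_nhdsWithin] with δ hδ
      simpa using hδ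
  refine (h1.comp ht).congr' ?_
  filter_upwards [self_mem_nhdsWithin] with δ hδ
  have hδ : 0 < δ := hδ
  have hx0 : 0 < Real.exp (-δ) := Real.exp_pos _
  have hx1 : Real.exp (-δ) < 1 := by simpa using hδ
  have hA := aux_Pt_hasSum hδ
  have hL : HasSum (fun c : ℕ => 1 / (c : ℝ) * (Real.exp (-δ)) ^ c) (- Real.log (1 - Real.exp (-δ))) := by
    have := Real.hasSum_pow_div_log_of_abs_lt_one (x := Real.exp (-δ)) (by rw [abs_of_pos hx0]; exact hx1)
    rw [← hasSum_nat_add_iff' 1]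
    simp only [Finset.sum_range_one, Nat.cast_zero, div_zero, zero_mul, sub_zero]
    refine this.congr_fun (fun n => ?_)
    push_cast; ring
  have := (hA.sub hL).tsum_eq
  simp only [Function.comp]
  rw [← sub_neg_eq_add, ← this]
  apply tsum_congr
  intro c; ring

lemma aux_const (M C : ℝ) (h : ∀ y : ℝ, 2 ≤ y →
    |(∑ p ∈ Nat.primesLE ⌊y⌋₊, 1 / (p : ℝ)) - Real.log (Real.log y) - M| ≤ C / Real.log y) :
    M = Real.eulerMascheroniConstant +
      ∑' p : Nat.Primes, (Real.log (1 - 1 / ((p : ℕ) : ℝ)) + 1 / ((p : ℕ) : ℝ)) := by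
  have h1 := aux_Pt_tendsto M C h
  set W := ∑' p : Nat.Primes, (Real.log (1 - 1 / ((p : ℕ) : ℝ)) + 1 / ((p : ℕ) : ℝ))
  set P : ℝ → ℝ := fun δ => ∑' p : Nat.Primes, ((p : ℕ) : ℝ) ^ (-(1 + δ)) with hP
  set Q : ℝ → ℝ := fun δ => ∑' p : Nat.Primes,
      1 / ((p : ℕ) : ℝ) * (Real.exp (-δ)) ^ ⌈Real.log ((p : ℕ) : ℝ)⌉₊ with hQ
  -- P δ + log δ → W
  have hPlog : Tendsto (fun δ => P δ + Real.log δ) (𝓝[>] 0) (𝓝 W) := by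
    have := aux_zeta_log.add aux_W_tendsto
    rw [zero_add] at this
    refine this.congr' ?_
    filter_upwards [self_mem_nhdsWithin] with δ hδ
    simp only [hP]
    rw [aux_P_eq hδ]; ring
  have hid : Tendsto (fun δ : ℝ => δ) (𝓝[>] 0) (𝓝 0) := nhdsWithin_le_nhds
  have hdl : Tendsto (fun δ : ℝ => δ * Real.log δ) (𝓝[>] 0) (𝓝 0) := by
    have := Real.continuous_mul_log.tendsto 0
    rw [zero_mul] at this
    exact this.mono_left nhdsWithin_le_nhds
  have hdP : Tendsto (fun δ => δ * P δ) (𝓝[>] 0) (𝓝 0) := by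
    have := (hid.mul hPlog).sub hdl
    rw [zero_mul, sub_zero] at this
    refine this.congr (fun δ => by ring)
  have hPQ : Tendsto (fun δ => P δ - Q δ) (𝓝[>] 0) (𝓝 0) := by
    refine squeeze_zero' ?_ ?_ hdP
    · filter_upwards [self_mem_nhdsWithin] with δ hδ
      rw [sub_nonneg]
      exact Summable.tsum_le_tsum (fun p => (aux_term hδ p).1) (aux_Pt_summable hδ) (aux_P_summable hδ)
    · filter_upwards [self_mem_nhdsWithin] with δ hδ
      simp only [hP, hQ]
      rw [← (aux_P_summable hδ).tsum_sub (aux_Pt_summable hδ), ← tsum_mul_left]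
      exact Summable.tsum_le_tsum (fun p => (aux_term hδ p).2)
        ((aux_P_summable hδ).sub (aux_Pt_summable hδ)) ((aux_P_summable hδ).mul_left δ)
  have h2 := (hPlog.sub hPQ).add aux_exp_log
  rw [sub_zero, add_zero] at h2
  have h3 : Tendsto (fun δ => Q δ + Real.log (1 - Real.exp (-δ))) (𝓝[>] 0) (𝓝 W) :=
    h2.congr (fun δ => by ring)
  have := tendsto_nhds_unique h1 h3
  linarith

end

section
lemma aux_pow_dvd_lcm {k : ℕ} (n : Fin k → ℕ) (hn : ∀ j, n j ≠ 0) (p e : ℕ) (hp : p.Prime)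
    (he : 1 ≤ e) : p ^ e ∣ Finset.univ.lcm n ↔ ∃ j, p ^ e ∣ n j := by
  have hL : Finset.univ.lcm n ≠ 0 := by
    rw [Ne, Finset.lcm_eq_zero_iff]
    rintro ⟨j, _, hj⟩
    exact hn j hj
  rw [hp.pow_dvd_iff_le_factorization hL, Finset.factorization_lcm (fun j _ => hn j),
    Finset.le_sup_iff (show (⊥ : ℕ) < e from he)]
  simp only [Finset.mem_univ, true_and]
  apply exists_congr
  intro j
  rw [hp.pow_dvd_iff_le_factorization (hn j)]

lemma aux_B {k : ℕ} (N : ℕ) (n : Fin k → ℕ)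
    (hn : n ∈ Fintype.piFinset (fun _ : Fin k => Finset.Icc 1 N)) :
    ((∑ p ∈ (Finset.univ.lcm n).primeFactors,
              ((Finset.univ.lcm n).factorization p : ℝ) * (p : ℝ)) -
            ∑ p ∈ (Finset.univ.lcm n).primeFactors, (p : ℝ)) =
    ∑ p ∈ Nat.primesLE N, ∑ i ∈ Finset.range N,
      if (∃ j, p ^ (i + 2) ∣ n j) then (p : ℝ) else 0 := by
  rw [Fintype.mem_piFinset] at hn
  have hn0 : ∀ j, n j ≠ 0 := fun j => by
    have := Finset.mem_Icc.1 (hn j); omega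
  have hnN : ∀ j, n j ≤ N := fun j => (Finset.mem_Icc.1 (hn j)).2
  have hdv := aux_pow_dvd_lcm n hn0
  have hL : Finset.univ.lcm n ≠ 0 := by
    rw [Ne, Finset.lcm_eq_zero_iff]
    rintro ⟨j, _, hj⟩
    exact hn0 j hj
  set L := Finset.univ.lcm n
  rw [← Finset.sum_sub_distrib]
  have h1 : ∑ p ∈ L.primeFactors, ((L.factorization p : ℝ) * p - p) =
      ∑ p ∈ Nat.primesLE N, (((L.factorization p - 1 : ℕ) : ℝ) * p) := by
    have h2 : ∑ p ∈ L.primeFactors, ((L.factorization p : ℝ) * p - p) =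
      ∑ p ∈ L.primeFactors, (((L.factorization p - 1 : ℕ) : ℝ) * p) := by
      apply Finset.sum_congr rfl
      intro p hp
      have : 1 ≤ L.factorization p := by
        rw [Nat.mem_primeFactors] at hp
        exact (hp.1.dvd_iff_one_le_factorization hL).1 hp.2.1
      rw [Nat.cast_sub this]; push_cast; ring
    rw [h2]
    apply Finset.sum_subset
    · intro p hp
      rw [Nat.mem_primeFactors] at hp
      obtain ⟨j, hj⟩ := (hdv p 1 hp.1 le_rfl).1 (by simpa using hp.2.1)
      rw [pow_one] at hj
      rw [Nat.mem_primesLE]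
      exact ⟨(Nat.le_of_dvd (Nat.pos_of_ne_zero (hn0 j)) hj).trans (hnN j), hp.1⟩
    · intro p _ hp
      rw [← Nat.support_factorization, Finsupp.notMem_support_iff] at hp
      simp [hp]
  rw [h1]
  apply Finset.sum_congr rfl
  intro p hp
  have hpp := Nat.prime_of_mem_primesLE hp
  have h3 : ∀ i, (∃ j, p ^ (i + 2) ∣ n j) ↔ i < L.factorization p - 1 := by
    intro i
    rw [← hdv p (i + 2) hpp (by omega), hpp.pow_dvd_iff_le_factorization hL]
    omega
  have h4 : L.factorization p - 1 ≤ N := by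
    rcases Nat.eq_zero_or_pos (L.factorization p) with h | h
    · omega
    · obtain ⟨j, hj⟩ := (hdv p _ hpp h).1 (Nat.ordProj_dvd L p)
      have h5 := Nat.le_of_dvd (Nat.pos_of_ne_zero (hn0 j)) hj
      have h6 := Nat.lt_pow_self hpp.one_lt (n := L.factorization p)
      have := hnN j
      omega
  simp_rw [h3]
  rw [← Finset.sum_filter]
  have h5 : (Finset.range N).filter (fun i => i < L.factorization p - 1) =
      Finset.range (L.factorization p - 1) := by
    ext i
    simp only [Finset.mem_filter, Finset.mem_range]
    omega
  rw [h5]; simp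

lemma aux_count (k N q : ℕ) :
    ((((Fintype.piFinset (fun _ : Fin k => Finset.Icc 1 N)).filter
      (fun n => ∃ j, q ∣ n j)).card : ℕ) : ℝ) = (N : ℝ) ^ k - ((N : ℝ) - (N / q : ℕ)) ^ k := by
  have h1 : ((Finset.Icc 1 N).filter (fun m => ¬ q ∣ m)).card = N - N / q := by
    have h := Finset.card_filter_add_card_filter_not (s := Finset.Icc 1 N) (fun m => q ∣ m)
    have h2 : ((Finset.Icc 1 N).filter (fun m => q ∣ m)).card = N / q := by
      have := Nat.Ioc_filter_dvd_card_eq_div N q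
      rwa [← Finset.Icc_add_one_left_eq_Ioc, zero_add] at this
    rw [h2, Nat.card_Icc] at h
    omega
  have h2 : ((Fintype.piFinset (fun _ : Fin k => Finset.Icc 1 N)).filter
      (fun n => ¬ ∃ j, q ∣ n j)) = Fintype.piFinset (fun _ : Fin k => (Finset.Icc 1 N).filter (fun m => ¬ q ∣ m)) := by
    ext n
    simp only [Finset.mem_filter, Fintype.mem_piFinset]
    push Not
    exact ⟨fun h j => ⟨h.1 j, h.2 j⟩, fun h => ⟨fun j => (h j).1, fun j => (h j).2⟩⟩
  have h3 := Finset.card_filter_add_card_filter_not (s := Fintype.piFinset (fun _ : Fin k => Finset.Icc 1 N)) (fun n => ∃ j, q ∣ n j)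
  rw [h2, Fintype.card_piFinset_const, Fintype.card_piFinset_const, h1, Nat.card_Icc, Nat.add_sub_cancel] at h3
  have h4 := congrArg (fun z : ℕ => (z : ℝ)) h3
  simp only [Nat.cast_add, Nat.cast_pow, Nat.cast_sub (Nat.div_le_self N q)] at h4
  linarith

lemma aux_S (k N : ℕ) :
    (∑ n ∈ Fintype.piFinset (fun _ : Fin k => Finset.Icc 1 N),
          ((∑ p ∈ (Finset.univ.lcm n).primeFactors,
              ((Finset.univ.lcm n).factorization p : ℝ) * (p : ℝ)) -
            ∑ p ∈ (Finset.univ.lcm n).primeFactors, (p : ℝ))) =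
    ∑ p ∈ Nat.primesLE N, ∑ i ∈ Finset.range N,
      (p : ℝ) * ((N : ℝ) ^ k - ((N : ℝ) - (N / p ^ (i + 2) : ℕ)) ^ k) := by
  rw [Finset.sum_congr rfl (fun n hn => aux_B N n hn), Finset.sum_comm]
  apply Finset.sum_congr rfl
  intro p _
  rw [Finset.sum_comm]
  apply Finset.sum_congr rfl
  intro i _
  rw [← aux_count, ← Finset.sum_filter, Finset.sum_const, nsmul_eq_mul, mul_comm]

end

section
/-- per-prime remainder -/
noncomputable def auxR (k : ℕ) (p : ℕ) : ℝ :=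
  (k : ℝ) * (1 / ((p : ℝ) - 1) - 1 / p) + ∑ j ∈ Finset.Icc 2 k, (-1 : ℝ) ^ (j - 1) * (Nat.choose k j : ℝ) *
    (1 / ((p : ℝ) ^ (j - 1) * ((p : ℝ) ^ j - 1)))

lemma aux_binom (k : ℕ) (hk : 2 ≤ k) (t : ℝ) :
    1 - (1 - t) ^ k = k * t + ∑ j ∈ Finset.Icc 2 k, (-1 : ℝ) ^ (j - 1) * (Nat.choose k j : ℝ) * t ^ j := by
  have h : (1 - t) ^ k = ∑ j ∈ Finset.range (k + 1), (-1 : ℝ) ^ j * (Nat.choose k j : ℝ) * t ^ j := by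
    rw [show (1 - t) = (-t) + 1 by ring, add_pow]
    apply Finset.sum_congr rfl
    intro j _
    rw [neg_pow]; simp; ring
  have h2 : Finset.range (k + 1) = insert 0 (insert 1 (Finset.Icc 2 k)) := by
    ext j; simp only [Finset.mem_range, Finset.mem_insert, Finset.mem_Icc]; omega
  rw [h, h2, Finset.sum_insert (by simp), Finset.sum_insert (by simp)]
  have h3 : ∑ j ∈ Finset.Icc 2 k, (-1 : ℝ) ^ j * (Nat.choose k j : ℝ) * t ^ j =
     - ∑ j ∈ Finset.Icc 2 k, (-1 : ℝ) ^ (j - 1) * (Nat.choose k j : ℝ) * t ^ j := by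
    rw [← Finset.sum_neg_distrib]
    apply Finset.sum_congr rfl
    intro j hj
    obtain ⟨i, rfl⟩ : ∃ i, j = i + 1 := ⟨j - 1, by rw [Finset.mem_Icc] at hj; omega⟩
    simp [pow_succ]
  rw [h3]; simp; ring

lemma aux_geom (p : ℝ) (hp : 2 ≤ p) (j : ℕ) (hj : 1 ≤ j) :
    HasSum (fun i : ℕ => p * ((1 / p ^ (i + 2)) ^ j)) (1 / (p ^ (j - 1) * (p ^ j - 1))) := by
  have hpj : 1 < p ^ j := one_lt_pow₀ (by linarith) (by omega)
  have h := (hasSum_geometric_of_lt_one (r := 1 / p ^ j) (by positivity)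
    (by rw [div_lt_one (by linarith)]; exact hpj)).mul_left (p * (1 / p ^ j) ^ 2)
  have e : p * (1 / p ^ j) ^ 2 * (1 - 1 / p ^ j)⁻¹ = 1 / (p ^ (j - 1) * (p ^ j - 1)) := by
    obtain ⟨i, rfl⟩ : ∃ i, j = i + 1 := ⟨j - 1, by omega⟩
    have h1 : p ^ (i + 1) - 1 ≠ 0 := by linarith
    have h2 : 1 - 1 / p ^ (i + 1) = (p ^ (i + 1) - 1) / p ^ (i + 1) := by
      field_simp
    have h3 : p ^ i ≠ 0 := by positivity
    have h4 : p ≠ 0 := by linarith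
    rw [h2, Nat.add_sub_cancel, inv_div]
    field_simp
    ring
  rw [e] at h
  refine h.congr_fun (fun i => ?_)
  rw [mul_assoc, ← pow_add]
  congr 1
  rw [one_div, one_div, inv_pow, inv_pow, ← pow_mul, ← pow_mul]
  congr 2; ring

lemma aux_T (k : ℕ) (hk : 2 ≤ k) (p : ℕ) (hp : p.Prime) :
    HasSum (fun i : ℕ => (p : ℝ) * (1 - (1 - 1 / (p : ℝ) ^ (i + 2)) ^ k)) (k / p + auxR k p) := by
  have hp2 : (2 : ℝ) ≤ p := by exact_mod_cast hp.two_le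
  have h1 := (aux_geom p hp2 1 le_rfl).mul_left (k : ℝ)
  have h2 := hasSum_sum (s := Finset.Icc 2 k) (fun j hj =>
    (aux_geom p hp2 j (by rw [Finset.mem_Icc] at hj; omega)).mul_left
      ((-1 : ℝ) ^ (j - 1) * (Nat.choose k j : ℝ)))
  have h3 := h1.add h2
  have e : (k : ℝ) / p + auxR k p = (k : ℝ) * (1 / ((p : ℝ) ^ (1 - 1) * ((p : ℝ) ^ 1 - 1))) +
    ∑ j ∈ Finset.Icc 2 k, (-1 : ℝ) ^ (j - 1) * (Nat.choose k j : ℝ) *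
    (1 / ((p : ℝ) ^ (j - 1) * ((p : ℝ) ^ j - 1))) := by
    rw [auxR]; simp only [Nat.sub_self, pow_zero, pow_one, one_mul]; ring
  rw [e]
  refine h3.congr_fun (fun i => ?_)
  rw [aux_binom k hk, mul_add, Finset.mul_sum]
  congr 1
  · ring
  · apply Finset.sum_congr rfl
    intro j _; ring

lemma aux_R_bound_j (p : ℝ) (hp : 2 ≤ p) (j : ℕ) (hj : 2 ≤ j) :
    0 ≤ 1 / (p ^ (j - 1) * (p ^ j - 1)) ∧ 1 / (p ^ (j - 1) * (p ^ j - 1)) ≤ 1 / p ^ 2 := by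
  have h1 : p ^ 1 ≤ p ^ (j - 1) := pow_le_pow_right₀ (by linarith) (by omega)
  have h2 : p ^ 2 ≤ p ^ j := pow_le_pow_right₀ (by linarith) hj
  have h3 : p ≤ p ^ j - 1 := by nlinarith
  rw [pow_one] at h1
  constructor
  · have : 0 ≤ p ^ j - 1 := by linarith
    positivity
  · apply one_div_le_one_div_of_le (by positivity)
    nlinarith

lemma aux_R_bound_1 (p : ℝ) (hp : 2 ≤ p) :
    0 ≤ 1 / (p - 1) - 1 / p ∧ 1 / (p - 1) - 1 / p ≤ 2 / p ^ 2 := by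
  have e : 1 / (p - 1) - 1 / p = 1 / (p * (p - 1)) := by
    have : p - 1 ≠ 0 := by linarith
    field_simp; ring
  rw [e]
  have : 0 < p - 1 := by linarith
  refine ⟨by positivity, ?_⟩
  rw [div_le_div_iff₀ (by positivity) (by positivity)]
  nlinarith

lemma aux_R_bound (k : ℕ) : ∃ K : ℝ, 0 ≤ K ∧ ∀ p : ℕ, 2 ≤ p → |auxR k p| ≤ K / (p : ℝ) ^ 2 := by
  refine ⟨k * 2 + ∑ j ∈ Finset.Icc 2 k, (Nat.choose k j : ℝ), by positivity, fun p hp => ?_⟩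
  have hp2 : (2 : ℝ) ≤ p := by exact_mod_cast hp
  rw [auxR, add_div, Finset.sum_div]
  refine (abs_add_le _ _).trans (add_le_add ?_ ((Finset.abs_sum_le_sum_abs _ _).trans (Finset.sum_le_sum ?_)))
  · obtain ⟨h1, h2⟩ := aux_R_bound_1 p hp2
    rw [abs_of_nonneg (by positivity), mul_div_assoc]
    gcongr
  · intro j hj
    rw [Finset.mem_Icc] at hj
    obtain ⟨h1, h2⟩ := aux_R_bound_j p hp2 j hj.1
    rw [abs_mul, abs_mul, abs_pow, abs_neg, abs_one, one_pow, one_mul, Nat.abs_cast, abs_of_nonneg h1]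
    rw [div_eq_mul_one_div (Nat.choose k j : ℝ)]
    gcongr

lemma aux_lip (k : ℕ) (s t : ℝ) (hs : 0 ≤ s) (hs1 : s ≤ 1) (ht : 0 ≤ t) (ht1 : t ≤ 1) :
    |(1 - s) ^ k - (1 - t) ^ k| ≤ k * |s - t| := by
  have h := abs_pow_sub_pow_le (1 - s) (1 - t) k
  have h1 : max |1 - s| |1 - t| ^ (k - 1) ≤ 1 := by
    apply pow_le_one₀ (by positivity)
    apply max_le <;> rw [abs_le] <;> constructor <;> linarith
  have h2 : |1 - s - (1 - t)| = |s - t| := by rw [abs_sub_comm]; congr 1; ring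
  rw [h2] at h
  refine h.trans ?_
  calc _ ≤ |s - t| * k * 1 := by gcongr
    _ = _ := by ring

lemma aux_floor_err (N q : ℕ) (hN : 1 ≤ N) (hq : 1 ≤ q) :
    |((N / q : ℕ) : ℝ) / N - 1 / q| ≤ √(1 / N) * √(1 / q) := by
  have hN0 : (0 : ℝ) < N := by exact_mod_cast hN
  have hq0 : (0 : ℝ) < q := by exact_mod_cast hq
  rw [← Real.sqrt_mul (by positivity)]
  have h1 : ((N / q : ℕ) : ℝ) ≤ (N : ℝ) / q := Nat.cast_div_le
  have h3 : (N : ℝ) / q < (N / q : ℕ) + 1 := by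
    have := Nat.lt_floor_add_one ((N : ℝ) / q)
    rwa [Nat.floor_div_eq_div] at this
  have h0 : (0 : ℝ) ≤ ((N / q : ℕ) : ℝ) := Nat.cast_nonneg _
  set m := ((N / q : ℕ) : ℝ)
  have e : |m / N - 1 / q| = ((N : ℝ) / q - m) * (1 / (N : ℝ)) := by
    rw [abs_sub_comm, abs_of_nonneg]
    · field_simp
    · rw [sub_nonneg, div_le_div_iff₀ hN0 hq0]
      rw [le_div_iff₀ hq0] at h1
      linarith
  rw [e]
  apply Real.le_sqrt_of_sq_le
  have hd0 : 0 ≤ (N : ℝ) / q - m := by linarith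
  have hd1 : ((N : ℝ) / q - m) * ((N : ℝ) / q - m) ≤ 1 * ((N : ℝ) / q) := by
    apply mul_le_mul <;> linarith
  calc (((N : ℝ) / q - m) * (1 / (N : ℝ))) ^ 2 = (((N : ℝ) / q - m) * ((N : ℝ) / q - m)) * (1 / (N : ℝ)) ^ 2 := by ring
    _ ≤ (1 * ((N : ℝ) / q)) * (1 / (N : ℝ)) ^ 2 := by gcongr
    _ = _ := by field_simp

lemma aux_prime_err (k : ℕ) (hk : 2 ≤ k) (N : ℕ) (hN : 1 ≤ N) (p : ℕ) (hp : p.Prime) :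
    |(∑ i ∈ Finset.range N, (p : ℝ) * (1 - (1 - ((N / p ^ (i + 2) : ℕ) : ℝ) / N) ^ k))
      - (k / p + auxR k p)| ≤ 4 * k * √(1 / N) := by
  have hp2 : (2 : ℝ) ≤ p := by exact_mod_cast hp.two_le
  have hN0 : (0 : ℝ) < N := by exact_mod_cast hN
  have h1 : HasSum (fun i : ℕ => (p : ℝ) * (1 - (1 - ((N / p ^ (i + 2) : ℕ) : ℝ) / N) ^ k))
      (∑ i ∈ Finset.range N, (p : ℝ) * (1 - (1 - ((N / p ^ (i + 2) : ℕ) : ℝ) / N) ^ k)) := by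
    apply hasSum_sum_of_ne_finset_zero
    intro i hi
    rw [Finset.mem_range, not_lt] at hi
    have : N / p ^ (i + 2) = 0 := by
      apply Nat.div_eq_of_lt
      have := Nat.lt_pow_self hp.one_lt (n := i + 2)
      omega
    rw [this]; simp
  have h2 := h1.sub (aux_T k hk p hp)
  set z := √(1 / (p : ℝ)) with hz
  have hz0 : 0 ≤ z := Real.sqrt_nonneg _
  have hzz : z ^ 2 = 1 / p := Real.sq_sqrt (by positivity)
  have hz34 : z ≤ 3 / 4 := by
    rw [hz]
    apply Real.sqrt_le_iff.2 ⟨by norm_num, ?_⟩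
    have := one_div_le_one_div_of_le (by norm_num) hp2
    linarith
  have hg := ((hasSum_geometric_of_lt_one hz0 (by linarith)).mul_left (p * k * √(1 / N) * z ^ 2))
  have hb := h2.norm_le_of_bounded hg (fun i => by
    have hq1 : 1 ≤ p ^ (i + 2) := Nat.one_le_pow _ _ hp.pos
    have hq1' : (1 : ℝ) ≤ (p : ℝ) ^ (i + 2) := by exact_mod_cast hq1
    have hfe := aux_floor_err N (p ^ (i + 2)) hN hq1
    have hl := aux_lip k (((N / p ^ (i + 2) : ℕ) : ℝ) / N) (1 / (p : ℝ) ^ (i + 2)) (by positivity)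
      (by rw [div_le_one hN0]; exact_mod_cast Nat.div_le_self _ _) (by positivity)
      (by rw [div_le_one (by linarith)]; exact hq1')
    have hsq : √(1 / ((p ^ (i + 2) : ℕ) : ℝ)) = z ^ (i + 2) := by
      apply (Real.sqrt_eq_iff_mul_self_eq (by positivity) (by positivity)).2
      push_cast
      rw [← pow_two, ← pow_mul, mul_comm, pow_mul, hzz, div_pow, one_pow]
    rw [hsq] at hfe
    push_cast at hfe
    rw [← mul_sub, norm_mul, Real.norm_of_nonneg (by linarith), Real.norm_eq_abs]
    have e : ∀ a b : ℝ, 1 - a - (1 - b) = - (a - b) := fun a b => by ring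
    rw [e, abs_neg]
    calc (p : ℝ) * _ ≤ p * (k * (√(1 / N) * z ^ (i + 2))) := by
          gcongr
          refine hl.trans ?_
          gcongr
      _ = _ := by ring)
  rw [Real.norm_eq_abs] at hb
  refine hb.trans ?_
  rw [hzz]
  have : (1 - z)⁻¹ ≤ 4 := by
    rw [inv_le_comm₀ (by linarith) (by norm_num)]; linarith
  calc _ = (k * √(1 / N)) * (1 - z)⁻¹ := by field_simp
    _ ≤ (k * √(1 / N)) * 4 := by gcongr
    _ = _ := by ring

end

section
lemma aux_tele (n : ℕ) (hn : 1 ≤ n) :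
    HasSum (fun i : ℕ => 1 / ((i : ℝ) + n) - 1 / ((i : ℝ) + n + 1)) (1 / (n : ℝ)) := by
  have hn0 : (0 : ℝ) < n := by exact_mod_cast hn
  rw [hasSum_iff_tendsto_nat_of_nonneg]
  · have e : ∀ m : ℕ, ∑ i ∈ Finset.range m, (1 / ((i : ℝ) + n) - 1 / ((i : ℝ) + n + 1)) =
        1 / (n : ℝ) - 1 / ((m : ℝ) + n) := by
      intro m
      induction m with
      | zero => simp
      | succ m ih => rw [Finset.sum_range_succ, ih]; push_cast; ring
    simp_rw [e]
    have h : Filter.Tendsto (fun m : ℕ => 1 / ((m : ℝ) + n)) Filter.atTop (nhds 0) := by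
      simp_rw [one_div]
      exact (Filter.tendsto_atTop_add_const_right _ _ tendsto_natCast_atTop_atTop).inv_tendsto_atTop
    simpa using h.const_sub (1 / (n : ℝ))
  · intro i
    rw [sub_nonneg]
    apply one_div_le_one_div_of_le (by positivity) (by linarith)

lemma aux_tail (f : ℕ → ℝ) (K : ℝ) (hK : 0 ≤ K) (hf : ∀ p : ℕ, 2 ≤ p → |f p| ≤ K / (p : ℝ) ^ 2)
    (n : ℕ) (hn : 1 ≤ n) :
    |(∑ p ∈ Nat.primesLE n, f p) - ∑' p : Nat.Primes, f p| ≤ K / n := by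
  classical
  set g := Set.indicator {p : ℕ | p.Prime} f with hg
  have hn0 : (0 : ℝ) < n := by exact_mod_cast hn
  have h1 : ∑' p : Nat.Primes, f p = ∑' m, g m := tsum_subtype {p : ℕ | p.Prime} f
  have hb : ∀ m ≥ 1, ∀ i, ‖g (i + (m + 1))‖ ≤ K * (1 / ((i : ℝ) + m) - 1 / ((i : ℝ) + m + 1)) := by
    intro m hm i
    have hm0 : (0 : ℝ) < m := by exact_mod_cast hm
    have h2 : ‖g (i + (m + 1))‖ ≤ K / ((i + (m + 1) : ℕ) : ℝ) ^ 2 := by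
      refine (norm_indicator_le_norm_self _ _).trans ?_
      exact hf _ (by omega)
    refine h2.trans ?_
    rw [div_eq_mul_one_div]
    gcongr
    push_cast
    have : 1 / ((i : ℝ) + m) - 1 / ((i : ℝ) + m + 1) = 1 / (((i : ℝ) + m) * ((i : ℝ) + m + 1)) := by
      field_simp; ring
    rw [this]
    apply one_div_le_one_div_of_le (by positivity)
    have : (0 : ℝ) ≤ i := by positivity
    nlinarith
  have hsum : Summable g := by
    rw [← summable_nat_add_iff (1 + 1)]
    exact Summable.of_norm_bounded ((aux_tele 1 le_rfl).mul_left K).summable (by simpa using hb 1 le_rfl)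
  have h2 : ∑ p ∈ Nat.primesLE n, f p = ∑ i ∈ Finset.range (n + 1), g i := by
    rw [Nat.primesLE_eq_filter_range, Finset.sum_filter]
    apply Finset.sum_congr rfl
    intro i _
    rw [hg, Set.indicator_apply]; rfl
  rw [h1, h2, ← hsum.sum_add_tsum_nat_add (n + 1), sub_add_cancel_left, abs_neg]
  have := tsum_of_norm_bounded ((aux_tele n hn).mul_left K) (hb n hn)
  rw [Real.norm_eq_abs] at this
  rwa [mul_one_div] at this

lemma aux_prime_summable (f : ℕ → ℝ) (K : ℝ) (hf : ∀ p : ℕ, 2 ≤ p → |f p| ≤ K / (p : ℝ) ^ 2) :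
    Summable (fun p : Nat.Primes => f p) := by
  refine Summable.of_norm_bounded (aux_summable_sq.mul_left (K / 2)) (fun p => ?_)
  refine (hf p p.2.two_le).trans (le_of_eq ?_)
  rw [div_pow, one_pow]; ring

lemma aux_H (k : ℕ) :
    (k : ℝ) * (Real.eulerMascheroniConstant +
              ∑' p : Nat.Primes,
                (Real.log (1 - 1 / ((p : ℕ) : ℝ)) + 1 / (((p : ℕ) : ℝ) - 1))) +
            ∑ j ∈ Finset.Icc 2 k, (-1 : ℝ) ^ (j - 1) * (Nat.choose k j : ℝ) *
              ∑' p : Nat.Primes,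
                1 / (((p : ℕ) : ℝ) ^ (j - 1) * (((p : ℕ) : ℝ) ^ j - 1)) =
    k * (Real.eulerMascheroniConstant + ∑' p : Nat.Primes, (Real.log (1 - 1 / ((p : ℕ) : ℝ)) + 1 / ((p : ℕ) : ℝ)))
      + ∑' p : Nat.Primes, auxR k p := by
  have s1 : Summable (fun p : Nat.Primes => 1 / (((p : ℕ) : ℝ) - 1) - 1 / ((p : ℕ) : ℝ)) :=
    aux_prime_summable (fun p => 1 / ((p : ℝ) - 1) - 1 / (p : ℝ)) 2 (fun p hp => by
      have hp2 : (2 : ℝ) ≤ p := by exact_mod_cast hp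
      obtain ⟨a, b⟩ := aux_R_bound_1 p hp2
      rwa [abs_of_nonneg a])
  have s2 : ∀ j ∈ Finset.Icc 2 k, Summable (fun p : Nat.Primes =>
      (-1 : ℝ) ^ (j - 1) * (Nat.choose k j : ℝ) *
        (1 / (((p : ℕ) : ℝ) ^ (j - 1) * (((p : ℕ) : ℝ) ^ j - 1)))) := fun j hj =>
    (aux_prime_summable (fun p => 1 / ((p : ℝ) ^ (j - 1) * ((p : ℝ) ^ j - 1))) 1 (fun p hp => by
      have hp2 : (2 : ℝ) ≤ p := by exact_mod_cast hp
      obtain ⟨a, b⟩ := aux_R_bound_j p hp2 j (Finset.mem_Icc.1 hj).1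
      rwa [abs_of_nonneg a])).mul_left _
  have s3 : Summable (fun p : Nat.Primes => Real.log (1 - 1 / ((p : ℕ) : ℝ)) + 1 / ((p : ℕ) : ℝ)) := by
    have := aux_W_summable (s := 1) le_rfl
    simpa only [Real.rpow_neg_one, one_div] using this
  have e1 : ∑' p : Nat.Primes, (Real.log (1 - 1 / ((p : ℕ) : ℝ)) + 1 / (((p : ℕ) : ℝ) - 1)) =
      ∑' p : Nat.Primes, (Real.log (1 - 1 / ((p : ℕ) : ℝ)) + 1 / ((p : ℕ) : ℝ)) +
      ∑' p : Nat.Primes, (1 / (((p : ℕ) : ℝ) - 1) - 1 / ((p : ℕ) : ℝ)) := by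
    rw [← s3.tsum_add s1]
    apply tsum_congr; intro p; ring
  have e2 : ∑' p : Nat.Primes, auxR k p =
      k * ∑' p : Nat.Primes, (1 / (((p : ℕ) : ℝ) - 1) - 1 / ((p : ℕ) : ℝ)) +
      ∑ j ∈ Finset.Icc 2 k, (-1 : ℝ) ^ (j - 1) * (Nat.choose k j : ℝ) *
              ∑' p : Nat.Primes,
                1 / (((p : ℕ) : ℝ) ^ (j - 1) * (((p : ℕ) : ℝ) ^ j - 1)) := by
    simp_rw [← tsum_mul_left]
    rw [← Summable.tsum_finsetSum s2, ← (s1.mul_left (k : ℝ)).tsum_add (summable_sum s2)]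
    rfl
  rw [e1, e2]; ring

lemma aux_S2 (k N n : ℕ) (hk : 2 ≤ k) (hN : 1 ≤ N) (hn : ∀ p, p ≤ n ↔ p ^ 2 ≤ N) :
    ∑ p ∈ Nat.primesLE N, ∑ i ∈ Finset.range N, (p : ℝ) * ((N : ℝ) ^ k - ((N : ℝ) - (N / p ^ (i + 2) : ℕ)) ^ k)
    = (N : ℝ) ^ k * ∑ p ∈ Nat.primesLE n, ∑ i ∈ Finset.range N, (p : ℝ) * (1 - (1 - ((N / p ^ (i + 2) : ℕ) : ℝ) / N) ^ k) := by
  have hN0 : (N : ℝ) ≠ 0 := by positivity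
  have hnN : n ≤ N := by
    have := (hn n).1 le_rfl
    nlinarith
  rw [Finset.mul_sum]
  symm
  rw [← Finset.sum_subset (Nat.primesLE_mono hnN) (f := fun p : ℕ => ∑ i ∈ Finset.range N, (p : ℝ) * ((N : ℝ) ^ k - ((N : ℝ) - (N / p ^ (i + 2) : ℕ)) ^ k))]
  · apply Finset.sum_congr rfl
    intro p _
    rw [Finset.mul_sum]
    apply Finset.sum_congr rfl
    intro i _
    have : (N : ℝ) - (N / p ^ (i + 2) : ℕ) = N * (1 - ((N / p ^ (i + 2) : ℕ) : ℝ) / N) := by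
      rw [mul_sub, mul_one, mul_div_cancel₀ _ hN0]
    rw [this, mul_pow]; ring
  · intro p hp hp'
    rw [Nat.mem_primesLE] at hp hp'
    have h : ¬ p ^ 2 ≤ N := fun h => hp' ⟨(hn p).2 h, hp.2⟩
    apply Finset.sum_eq_zero
    intro i _
    have : N / p ^ (i + 2) = 0 := by
      apply Nat.div_eq_of_lt
      have := Nat.pow_le_pow_right hp.2.pos (show 2 ≤ i + 2 by omega)
      omega
    rw [this]; simp

lemma aux_main1 (k : ℕ) (hk : 2 ≤ k) (M C : ℝ) (hC : 0 ≤ C)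
    (hM : ∀ y : ℝ, 2 ≤ y → |(∑ p ∈ Nat.primesLE ⌊y⌋₊, 1 / (p : ℝ)) - Real.log (Real.log y) - M| ≤ C / Real.log y)
    (K : ℝ) (hK : 0 ≤ K) (hR : ∀ p : ℕ, 2 ≤ p → |auxR k p| ≤ K / (p : ℝ) ^ 2)
    (N : ℕ) (hN : 1 ≤ N) (y : ℝ) (hy : 2 ≤ y) :
    |(∑ p ∈ Nat.primesLE ⌊y⌋₊, ∑ i ∈ Finset.range N, (p : ℝ) * (1 - (1 - ((N / p ^ (i + 2) : ℕ) : ℝ) / N) ^ k))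
      - (k * Real.log (Real.log y) + (k * M + ∑' p : Nat.Primes, auxR k p))| ≤
      (Nat.primeCounting ⌊y⌋₊) * (4 * k * √(1 / N)) + k * (C / Real.log y) + K / (⌊y⌋₊ : ℕ) := by
  set n := ⌊y⌋₊
  have hn : 1 ≤ n := Nat.le_floor (by norm_num; linarith)
  have h1 := aux_tail (auxR k) K hK hR n hn
  have h2 := hM y hy
  have h3 : |∑ p ∈ Nat.primesLE n, ((∑ i ∈ Finset.range N, (p : ℝ) * (1 - (1 - ((N / p ^ (i + 2) : ℕ) : ℝ) / N) ^ k)) - (k / p + auxR k p))| ≤ (Nat.primeCounting n) * (4 * k * √(1 / N)) := by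
    refine (Finset.abs_sum_le_sum_abs _ _).trans ?_
    rw [← Nat.primesLE_card_eq_primeCounting, ← nsmul_eq_mul]
    apply Finset.sum_le_card_nsmul
    intro p hp
    exact aux_prime_err k hk N hN p (Nat.prime_of_mem_primesLE hp)
  have h4 : |(k : ℝ) * ((∑ p ∈ Nat.primesLE n, 1 / (p : ℝ)) - Real.log (Real.log y) - M)| ≤ k * (C / Real.log y) := by
    rw [abs_mul, Nat.abs_cast]; gcongr
  rw [Finset.sum_sub_distrib, Finset.sum_add_distrib] at h3
  have e : ∑ p ∈ Nat.primesLE n, (k : ℝ) / p = k * ∑ p ∈ Nat.primesLE n, 1 / (p : ℝ) := by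
    rw [Finset.mul_sum]; simp_rw [mul_one_div]
  rw [e] at h3
  refine le_trans (le_of_eq ?_) ((abs_add_three _ _ _).trans (add_le_add (add_le_add h3 h4) h1))
  congr 1; ring

end

lemma aux_final (k : ℕ) (hk : 2 ≤ k) (x y H K C L P S : ℝ) (N : ℕ) (hy : 4 ≤ y) (hxy : x = y ^ 2)
    (hN : N = ⌊x⌋₊) (hK : 0 ≤ K) (hP : P ≤ L * y / Real.log y)
    (hS : |S - (k * Real.log (Real.log y) + H)| ≤
      P * (4 * k * √(1 / N)) + k * (C / Real.log y) + K / (⌊y⌋₊ : ℕ)) (hL : 0 ≤ L) (hC : 0 ≤ C) :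
    |(N : ℝ) ^ k * S - (k * x ^ k * Real.log (Real.log y) + H * x ^ k)| ≤
      (16 * k * L + 2 * k * C + 4 * K + 2 * k * (k + |H|) + 1) * x ^ k / (2 * Real.log y) := by
  have hx16 : 16 ≤ x := by nlinarith
  have hl1 : 1 ≤ Real.log y := by
    rw [Real.le_log_iff_exp_le (by linarith)]
    linarith [Real.exp_one_lt_d9]
  have hly : Real.log y ≤ y := by linarith [Real.log_le_sub_one_of_pos (show 0 < y by linarith)]
  set l := Real.log y with hl
  have hl0 : 0 < l := by linarith
  have hy0 : 0 < y := by linarith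
  have hN1 : (N : ℝ) ≤ x := by rw [hN]; exact Nat.floor_le (by linarith)
  have hN2 : x - 1 < N := by rw [hN]; exact Nat.sub_one_lt_floor x
  have hf : y / 2 ≤ (⌊y⌋₊ : ℕ) := by linarith [Nat.sub_one_lt_floor y]
  have hN0 : (0 : ℝ) < N := by linarith
  have hsq : √(1 / (N : ℝ)) ≤ 2 / y := by
    apply Real.sqrt_le_iff.2 ⟨by positivity, ?_⟩
    rw [div_pow, ← hxy, div_le_div_iff₀ hN0 (by linarith)]
    linarith
  have E1 : P * (4 * k * √(1 / N)) ≤ 16 * k * L / (2 * l) := by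
    calc P * (4 * k * √(1 / N)) ≤ (L * y / l) * (4 * k * (2 / y)) := by gcongr
      _ = _ := by field_simp; ring
  have E2 : k * (C / l) = 2 * k * C / (2 * l) := by field_simp
  have E3 : K / (⌊y⌋₊ : ℕ) ≤ 4 * K / (2 * l) := by
    calc K / (⌊y⌋₊ : ℕ) ≤ K / (y / 2) := by gcongr
      _ ≤ K / (l / 2) := by gcongr
      _ = _ := by field_simp; ring
  set A := k * Real.log l + H with hA
  have hA1 : |A| ≤ (k + |H|) * y := by
    have h1 : 0 ≤ Real.log l := Real.log_nonneg hl1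
    have h2 : Real.log l ≤ y := by linarith [Real.log_le_sub_one_of_pos hl0]
    calc |A| ≤ |k * Real.log l| + |H| := abs_add_le _ _
      _ = k * Real.log l + |H| := by rw [abs_of_nonneg (by positivity)]
      _ ≤ k * y + |H| * y := by
        gcongr
        nlinarith [abs_nonneg H]
      _ = _ := by ring
  have hpow : |(N : ℝ) ^ k - x ^ k| ≤ k * x ^ (k - 1) := by
    have h := abs_pow_sub_pow_le (N : ℝ) x k
    have h1 : max |(N : ℝ)| |x| = x := by
      rw [abs_of_pos hN0, abs_of_pos (by linarith), max_eq_right hN1]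
    rw [h1] at h
    have h2 : |(N : ℝ) - x| ≤ 1 := by rw [abs_le]; constructor <;> linarith
    refine h.trans ?_
    have hx0 : 0 ≤ x := by linarith
    calc _ ≤ 1 * (k : ℝ) * x ^ (k - 1) := by gcongr
      _ = _ := by ring
  have hx0 : 0 < x := by linarith
  have hxk : x ^ (k - 1) * y ≤ 2 * x ^ k / (2 * l) := by
    obtain ⟨j, rfl⟩ : ∃ j, k = j + 1 := ⟨k - 1, by omega⟩
    rw [Nat.add_sub_cancel, le_div_iff₀ (by positivity), pow_succ]
    have : y * l ≤ x := by nlinarith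
    nlinarith [pow_pos hx0 j]
  have T1 : |(N : ℝ) ^ k * (S - A)| ≤ x ^ k * (16 * k * L / (2 * l) + 2 * k * C / (2 * l) + 4 * K / (2 * l)) := by
    rw [abs_mul, abs_of_nonneg (by positivity)]
    gcongr
    linarith
  have T2 : |((N : ℝ) ^ k - x ^ k) * A| ≤ k * (k + |H|) * (2 * x ^ k / (2 * l)) := by
    rw [abs_mul]
    calc _ ≤ (k * x ^ (k - 1)) * ((k + |H|) * y) := by gcongr
      _ = k * (k + |H|) * (x ^ (k - 1) * y) := by ring
      _ ≤ _ := by gcongr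
  have e : (N : ℝ) ^ k * S - (k * x ^ k * Real.log l + H * x ^ k) =
      (N : ℝ) ^ k * (S - A) + ((N : ℝ) ^ k - x ^ k) * A := by rw [hA]; ring
  rw [e]
  refine (abs_add_le _ _).trans ((add_le_add T1 T2).trans ?_)
  have : 0 ≤ x ^ k / (2 * l) := by positivity
  calc _ = (16 * k * L + 2 * k * C + 4 * K + 2 * k * (k + |H|)) * (x ^ k / (2 * l)) := by ring
    _ ≤ (16 * k * L + 2 * k * C + 4 * K + 2 * k * (k + |H|) + 1) * (x ^ k / (2 * l)) := by
      exact mul_le_mul_of_nonneg_right (by linarith) this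
    _ = _ := by ring

/-- **Lcm sums for `B(n) = A(n) − A*(n)`** (Theorem `Th_B_lcm`), where
`A(n) = Σ_{p^ν ∥ n} ν p` and `A*(n) = Σ_{p ∣ n} p` (here `ν = n.factorization p`).
For fixed `k ≥ 2`:
`Σ_{n₁,…,n_k ≤ x} B(lcm(n₁,…,n_k)) = k x^k log log √x + H_k x^k + O(x^k/log x)`,
where `H_k = k F + Σ_{j=2}^k (−1)^{j−1} binom(k,j) Σ_p 1/(p^{j−1}(p^j − 1))`,
`F = γ + Σ_p (log(1 − 1/p) + 1/(p−1))` (all series over primes absolutely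
convergent), and `log log √x = log((log x)/2)`. -/
theorem stmt_19 (k : ℕ) (hk : 2 ≤ k) :
    ∃ c > (0 : ℝ), ∃ x₀ : ℝ, 3 ≤ x₀ ∧ ∀ x ≥ x₀,
      |(∑ n ∈ Fintype.piFinset (fun _ : Fin k => Finset.Icc 1 ⌊x⌋₊),
          ((∑ p ∈ (Finset.univ.lcm n).primeFactors,
              ((Finset.univ.lcm n).factorization p : ℝ) * (p : ℝ)) -
            ∑ p ∈ (Finset.univ.lcm n).primeFactors, (p : ℝ))) -
        ((k : ℝ) * x ^ k * Real.log (Real.log x / 2) +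
          ((k : ℝ) * (Real.eulerMascheroniConstant +
              ∑' p : Nat.Primes,
                (Real.log (1 - 1 / ((p : ℕ) : ℝ)) + 1 / (((p : ℕ) : ℝ) - 1))) +
            ∑ j ∈ Finset.Icc 2 k, (-1 : ℝ) ^ (j - 1) * (Nat.choose k j : ℝ) *
              ∑' p : Nat.Primes,
                1 / (((p : ℕ) : ℝ) ^ (j - 1) * (((p : ℕ) : ℝ) ^ j - 1))) *
            x ^ k)| ≤
        c * x ^ k / Real.log x := by
  obtain ⟨M, C, hC, hM⟩ := aux_mertens2
  have hMc := aux_const M C hM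
  obtain ⟨K, hK, hR⟩ := aux_R_bound k
  obtain ⟨Y, hY⟩ := Filter.eventually_atTop.1 (Chebyshev.eventually_primeCounting_le (ε := 1) one_pos)
  rw [aux_H k, ← hMc]
  set H := (k : ℝ) * M + ∑' p : Nat.Primes, auxR k p with hH
  set L := Real.log 4 + 1 with hL
  have hL0 : 0 ≤ L := by
    have := Real.log_nonneg (show (1 : ℝ) ≤ 4 by norm_num)
    linarith
  refine ⟨16 * k * L + 2 * k * C + 4 * K + 2 * k * (k + |H|) + 1, by positivity,
    max 16 (Y ^ 2), le_max_of_le_left (by norm_num), fun x hx => ?_⟩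
  have hx16 : 16 ≤ x := (le_max_left _ _).trans hx
  have hxY : Y ^ 2 ≤ x := (le_max_right _ _).trans hx
  have hx0 : 0 ≤ x := by linarith
  have hy4 : 4 ≤ √x := Real.le_sqrt_of_sq_le (by linarith)
  have hyY : Y ≤ √x := (le_abs_self Y).trans (Real.abs_le_sqrt hxY)
  have hxy : x = (√x) ^ 2 := (Real.sq_sqrt hx0).symm
  have hly : Real.log x / 2 = Real.log √x := (Real.log_sqrt hx0).symm
  have hly2 : Real.log x = 2 * Real.log √x := by linarith
  have hN1 : 1 ≤ ⌊x⌋₊ := Nat.le_floor (by norm_num; linarith)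
  rw [aux_S, aux_S2 k ⌊x⌋₊ ⌊√x⌋₊ hk hN1 (fun p => by
    rw [Nat.le_floor_iff (Real.sqrt_nonneg x), Nat.le_floor_iff hx0, Real.le_sqrt (by positivity) hx0]
    push_cast; rfl), hly, hly2]
  exact aux_final k hk x (√x) H K C L _ _ ⌊x⌋₊ hy4 hxy rfl hK (hY _ hyY)
    (aux_main1 k hk M C hC hM K hK hR ⌊x⌋₊ hN1 (√x) (by linarith)) hL0 hC
end
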